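/- arXiv:0905.4443 — 4 statements merged into one kernel-verified Lean document; each statement's English description precedes it below -/
import Mathlib

section
/- Let X ⊆ 𝔸^n_ℝ be an irreducible closed curve (dimension 1) of degree d. Then for every ε > 0 there is a constant C = C(n,d,ε) such that N(X,B) ≤ C·B^{1/d+ε} for all B ≥ 1. -/
/-- The real zero set of an ideal of `ℝ[x_1,…,x_N]` in `ℝ^N`. -/
def zeroSetOf {N : ℕ} (I : Ideal (MvPolynomial (Fin N) ℝ)) : Set (Fin N → ℝ) :=
  {x | ∀ f ∈ I, MvPolynomial.eval x f = 0}

/-- The vanishing ideal of a subset of `ℝ^N`. -/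
noncomputable def vanishingIdeal {N : ℕ} (Z : Set (Fin N → ℝ)) : Ideal (MvPolynomial (Fin N) ℝ) where
  carrier := {f | ∀ x ∈ Z, MvPolynomial.eval x f = 0}
  add_mem' := by
    intro a b ha hb x hx
    simp [ha x hx, hb x hx]
  zero_mem' := by
    intro x hx
    simp
  smul_mem' := by
    intro c f hf x hx
    simp [smul_eq_mul, hf x hx]
/-- The affine Hilbert function of an ideal `I ⊆ K[x_1,…,x_N]`:
`AHF_I(s) = dim_K (K[x_1,…,x_N]_{≤s} / I_{≤s})`.  For large `s` it agrees with the
Hilbert function of the homogenization of `I`. -/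
noncomputable def affineHilbertFn {N : ℕ} (K : Type*) [Field K]
    (I : Ideal (MvPolynomial (Fin N) K)) (s : ℕ) : ℕ :=
  Module.finrank K
    (↥(MvPolynomial.restrictTotalDegree (Fin N) K s) ⧸
      (Submodule.comap (MvPolynomial.restrictTotalDegree (Fin N) K s).subtype
        (Submodule.restrictScalars K I)))

/-! ### Hilbert functions of filtered algebras -/

section Filtered

open Module Filter

theorem Submodule.finrank_map_add_finrank_inf_ker {K M N : Type*} [Field K] [AddCommGroup M]
    [Module K M] [AddCommGroup N] [Module K N] (W : Submodule K M) [FiniteDimensional K W]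
    (f : M →ₗ[K] N) :
    finrank K (W.map f) + finrank K (W ⊓ LinearMap.ker f : Submodule K M) = finrank K W := by
  have h := LinearMap.finrank_range_add_finrank_ker (f.domRestrict W)
  rw [LinearMap.range_domRestrict] at h
  have h2 : (LinearMap.ker (f.domRestrict W)).map W.subtype = W ⊓ LinearMap.ker f := by
    ext x
    simp [Submodule.mem_map, LinearMap.domRestrict_apply]
    tauto
  rw [← h2, Submodule.finrank_map_subtype_eq]
  exact h

variable {A : Type*} [CommRing A] [Algebra ℝ A] {V : Submodule ℝ A}

theorem pow_le_pow_succ_of_one_le (hV : 1 ≤ V) (s : ℕ) : V ^ s ≤ V ^ (s + 1) := by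
  rw [pow_succ]
  intro x hx
  simpa using Submodule.mul_mem_mul hx (Submodule.one_le.1 hV)

theorem pow_mono_of_one_le (hV : 1 ≤ V) : Monotone (fun s : ℕ => V ^ s) :=
  monotone_nat_of_le_succ (pow_le_pow_succ_of_one_le hV)

theorem mul_mem_pow_add {s t : ℕ} {a b : A} (ha : a ∈ V ^ s) (hb : b ∈ V ^ t) :
    a * b ∈ V ^ (s + t) := by
  rw [pow_add]
  exact Submodule.mul_mem_mul ha hb

theorem mul_mem_pow_succ {s : ℕ} {a b : A} (ha : a ∈ V) (hb : b ∈ V ^ s) :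
    a * b ∈ V ^ (s + 1) := by
  rw [pow_succ']
  exact Submodule.mul_mem_mul ha hb

/-- The elements which have order at most `s` after multiplication by a power of `u`. -/
def uSaturation {u : A} (hu : u ∈ V) (s : ℕ) : Submodule ℝ A where
  carrier := {f | ∃ k, u ^ k * f ∈ V ^ (s + k)}
  zero_mem' := ⟨0, by simp⟩
  add_mem' := by
    rintro a b ⟨k, hk⟩ ⟨l, hl⟩
    refine ⟨k + l, ?_⟩
    have h1 : u ^ l * (u ^ k * a) ∈ V ^ (l + (s + k)) :=
      mul_mem_pow_add (Submodule.pow_mem_pow V hu l) hk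
    have h2 : u ^ k * (u ^ l * b) ∈ V ^ (k + (s + l)) :=
      mul_mem_pow_add (Submodule.pow_mem_pow V hu k) hl
    rw [show l + (s + k) = s + (k + l) by ring] at h1
    rw [show k + (s + l) = s + (k + l) by ring] at h2
    convert add_mem h1 h2 using 1
    ring
  smul_mem' := by
    rintro c a ⟨k, hk⟩
    exact ⟨k, by simpa using (V ^ (s + k)).smul_mem c hk⟩

section Growth

variable {u : A} (hu : u ∈ V)

theorem pow_le_uSaturation (s : ℕ) : V ^ s ≤ uSaturation hu s :=
  fun f hf => ⟨0, by simpa using hf⟩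

theorem mul_mem_uSaturation_succ {s : ℕ} {v f : A} (hv : v ∈ V) (hf : f ∈ uSaturation hu s) :
    v * f ∈ uSaturation hu (s + 1) := by
  obtain ⟨k, hk⟩ := hf
  refine ⟨k, ?_⟩
  have := mul_mem_pow_succ hv hk
  rw [show s + 1 + k = s + k + 1 by ring]
  convert this using 1
  ring

theorem mem_uSaturation_of_mul_mem {s : ℕ} {f : A} (hf : u * f ∈ uSaturation hu (s + 1)) :
    f ∈ uSaturation hu s := by
  obtain ⟨k, hk⟩ := hf
  refine ⟨k + 1, ?_⟩
  rw [show s + (k + 1) = s + 1 + k by ring]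
  convert hk using 1
  ring

/-- The image of `V ^ (s + 1)` modulo the saturation of `V ^ s`. -/
def gradedPiece (s : ℕ) : Submodule ℝ (A ⧸ uSaturation hu s) :=
  (V ^ (s + 1)).map (uSaturation hu s).mkQ

/-- Multiplication by `u` on the quotients by the saturations. -/
def mulUQuotient (s : ℕ) : (A ⧸ uSaturation hu s) →ₗ[ℝ] (A ⧸ uSaturation hu (s + 1)) :=
  (uSaturation hu s).mapQ _ (LinearMap.mulLeft ℝ u)
    (by
      intro f hf
      rw [Submodule.mem_comap]
      exact mul_mem_uSaturation_succ hu hu hf)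

theorem mulUQuotient_mk (s : ℕ) (a : A) :
    mulUQuotient hu s (Submodule.Quotient.mk a) = Submodule.Quotient.mk (u * a) := rfl

theorem mulUQuotient_injective (s : ℕ) : Function.Injective (mulUQuotient hu s) := by
  rw [injective_iff_map_eq_zero]
  intro a
  obtain ⟨a, rfl⟩ := Submodule.mkQ_surjective _ a
  intro h
  rw [Submodule.mkQ_apply] at h ⊢
  rw [mulUQuotient_mk, Submodule.Quotient.mk_eq_zero] at h
  rw [Submodule.Quotient.mk_eq_zero]
  exact mem_uSaturation_of_mul_mem hu h

theorem map_gradedPiece_le (s : ℕ) :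
    (gradedPiece hu s).map (mulUQuotient hu s) ≤ gradedPiece hu (s + 1) := by
  rintro _ ⟨_, ⟨w, hw, rfl⟩, rfl⟩
  exact ⟨u * w, mul_mem_pow_succ hu hw, rfl⟩

theorem finrank_map_gradedPiece (s : ℕ) :
    finrank ℝ ((gradedPiece hu s).map (mulUQuotient hu s)) =
      finrank ℝ (gradedPiece hu s) :=
  (LinearEquiv.finrank_eq (Submodule.equivMapOfInjective _ (mulUQuotient_injective hu s) _)).symm

theorem gradedPiece_succ_le_iff (s : ℕ) :
    gradedPiece hu (s + 1) ≤ (gradedPiece hu s).map (mulUQuotient hu s) ↔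
      ∀ w ∈ V ^ (s + 2), ∃ b ∈ V ^ (s + 1), w - u * b ∈ uSaturation hu (s + 1) := by
  constructor
  · intro h w hw
    obtain ⟨_, ⟨b, hb, rfl⟩, hbw⟩ := h (Submodule.mem_map_of_mem hw)
    refine ⟨b, hb, ?_⟩
    rw [Submodule.mkQ_apply, Submodule.mkQ_apply, mulUQuotient_mk] at hbw
    rwa [eq_comm, Submodule.Quotient.eq] at hbw
  · rintro h _ ⟨w, hw, rfl⟩
    obtain ⟨b, hb, hbw⟩ := h w hw
    refine ⟨_, ⟨b, hb, rfl⟩, ?_⟩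
    rw [Submodule.mkQ_apply, Submodule.mkQ_apply, mulUQuotient_mk]
    rwa [eq_comm, Submodule.Quotient.eq]

theorem gradedPiece_stable (s : ℕ)
    (h : gradedPiece hu (s + 1) ≤ (gradedPiece hu s).map (mulUQuotient hu s)) :
    gradedPiece hu (s + 2) ≤ (gradedPiece hu (s + 1)).map (mulUQuotient hu (s + 1)) := by
  rw [gradedPiece_succ_le_iff] at h ⊢
  intro w hw
  rw [pow_succ'] at hw
  induction hw using Submodule.mul_induction_on' with
  | mem_mul_mem v hv w hw =>
    obtain ⟨b, hb, hbw⟩ := h w hw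
    refine ⟨v * b, mul_mem_pow_succ hv hb, ?_⟩
    convert mul_mem_uSaturation_succ hu hv hbw using 1
    ring
  | add x _ y _ hx hy =>
    obtain ⟨b, hb, hbw⟩ := hx
    obtain ⟨c, hc, hcw⟩ := hy
    refine ⟨b + c, add_mem hb hc, ?_⟩
    convert add_mem hbw hcw using 1
    ring

variable [FiniteDimensional ℝ V]

instance finiteDimensional_pow (s : ℕ) : FiniteDimensional ℝ (V ^ s : Submodule ℝ A) :=
  Module.Finite.iff_fg.2 ((Module.Finite.iff_fg.1 (inferInstanceAs (FiniteDimensional ℝ V))).pow s)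

instance finiteDimensional_gradedPiece (s : ℕ) : FiniteDimensional ℝ (gradedPiece hu s) := by
  unfold gradedPiece
  infer_instance

theorem finrank_gradedPiece_le_succ (s : ℕ) :
    finrank ℝ (gradedPiece hu s) ≤ finrank ℝ (gradedPiece hu (s + 1)) := by
  rw [← finrank_map_gradedPiece]
  exact Submodule.finrank_mono (map_gradedPiece_le hu s)

theorem finrank_gradedPiece_stable (s : ℕ)
    (h : finrank ℝ (gradedPiece hu (s + 1)) = finrank ℝ (gradedPiece hu s)) :
    finrank ℝ (gradedPiece hu (s + 2)) = finrank ℝ (gradedPiece hu (s + 1)) := by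
  have h1 := Submodule.eq_of_le_of_finrank_eq (map_gradedPiece_le hu s)
    (by rw [finrank_map_gradedPiece, h])
  have h2 := gradedPiece_stable hu s h1.ge
  apply le_antisymm _ (finrank_gradedPiece_le_succ hu (s + 1))
  rw [← finrank_map_gradedPiece hu (s + 1)]
  exact Submodule.finrank_mono h2

theorem finrank_gradedPiece_add_le (hV : 1 ≤ V) (s : ℕ) :
    finrank ℝ (gradedPiece hu s) + finrank ℝ (V ^ s : Submodule ℝ A) ≤
      finrank ℝ (V ^ (s + 1) : Submodule ℝ A) := by
  rw [← Submodule.finrank_map_add_finrank_inf_ker (V ^ (s + 1)) (uSaturation hu s).mkQ]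
  gcongr
  · exact le_rfl
  · apply Submodule.finrank_mono
    rw [Submodule.ker_mkQ]
    exact le_inf (pow_le_pow_succ_of_one_le hV s) (pow_le_uSaturation hu s)

theorem mem_pow_of_mul_mem_pow (hV : 1 ≤ V) (hu : u ∈ V) {d s₀ : ℕ}
    (hred : ∀ s ≥ s₀, ∀ w ∈ V ^ (s + 1), ∃ a ∈ V ^ s, ∃ b ∈ V ^ s, w = a + u * b)
    (hH : ∀ s ≥ s₀, finrank ℝ (V ^ (s + 1) : Submodule ℝ A) =
      finrank ℝ (V ^ s : Submodule ℝ A) + d) {s : ℕ} (hs : s₀ ≤ s) {g : A}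
    (hg : g ∈ V ^ (s + 1)) (hug : u * g ∈ V ^ (s + 1)) : g ∈ V ^ s := by
  set f : A →ₗ[ℝ] A ⧸ V ^ (s + 1) := (V ^ (s + 1)).mkQ ∘ₗ LinearMap.mulLeft ℝ u with hf
  have hker : ∀ x, x ∈ LinearMap.ker f ↔ u * x ∈ V ^ (s + 1) := by
    intro x
    simp [hf]
  have h1 := Submodule.finrank_map_add_finrank_inf_ker (V ^ (s + 1)) f
  have h2 := Submodule.finrank_map_add_finrank_inf_ker (V ^ (s + 2)) (V ^ (s + 1)).mkQ
  have h3 : (V ^ (s + 1)).map f = (V ^ (s + 2)).map (V ^ (s + 1)).mkQ := by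
    apply le_antisymm
    · rintro _ ⟨w, hw, rfl⟩
      exact ⟨u * w, mul_mem_pow_succ hu hw, rfl⟩
    · rintro _ ⟨w, hw, rfl⟩
      obtain ⟨a, ha, b, hb, rfl⟩ := hred (s + 1) (by omega) w hw
      refine ⟨b, hb, ?_⟩
      simp only [hf, LinearMap.comp_apply, LinearMap.mulLeft_apply, Submodule.mkQ_apply]
      rw [Submodule.Quotient.eq]
      simpa using ha
  rw [Submodule.ker_mkQ, inf_eq_right.2 (pow_le_pow_succ_of_one_le hV (s + 1))] at h2
  have h4 := hH s hs
  have h5 := hH (s + 1) (by omega)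
  rw [h3] at h1
  have h6 : V ^ s ≤ V ^ (s + 1) ⊓ LinearMap.ker f := by
    refine le_inf (pow_le_pow_succ_of_one_le hV s) fun x hx => ?_
    rw [hker]
    exact mul_mem_pow_succ hu hx
  have h7 := Submodule.eq_of_le_of_finrank_eq h6 (by
    rw [show s + 1 + 1 = s + 2 from rfl] at h5
    omega)
  rw [h7]
  exact ⟨hg, (hker g).2 hug⟩

theorem finrank_gradedPiece_eq (hV : 1 ≤ V) (hu : u ∈ V) {d s₀ : ℕ}
    (hred : ∀ s ≥ s₀, ∀ w ∈ V ^ (s + 1), ∃ a ∈ V ^ s, ∃ b ∈ V ^ s, w = a + u * b)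
    (hH : ∀ s ≥ s₀, finrank ℝ (V ^ (s + 1) : Submodule ℝ A) =
      finrank ℝ (V ^ s : Submodule ℝ A) + d) {s : ℕ} (hs : s₀ ≤ s) :
    finrank ℝ (gradedPiece hu s) = d := by
  have h := Submodule.finrank_map_add_finrank_inf_ker (V ^ (s + 1)) (uSaturation hu s).mkQ
  have h2 : V ^ (s + 1) ⊓ LinearMap.ker (uSaturation hu s).mkQ = V ^ s := by
    rw [Submodule.ker_mkQ]
    apply le_antisymm _ (le_inf (pow_le_pow_succ_of_one_le hV s) (pow_le_uSaturation hu s))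
    rintro g ⟨hg, k, hk⟩
    induction k with
    | zero => simpa using hk
    | succ k ih =>
      apply ih
      apply mem_pow_of_mul_mem_pow hV hu hred hH (by omega : s₀ ≤ s + k)
      · rw [show s + k + 1 = k + (s + 1) by ring]
        exact mul_mem_pow_add (Submodule.pow_mem_pow V hu k) hg
      · rwa [pow_succ', mul_assoc] at hk
  rw [h2, hH s hs] at h
  have h3 : finrank ℝ (gradedPiece hu s) =
    finrank ℝ ((V ^ (s + 1)).map (uSaturation hu s).mkQ) := rfl
  omega

/-- A linear lower bound, uniform in `d`, for the Hilbert function of a one-dimensional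
filtered algebra. -/
theorem mul_le_finrank_pow_add (hV : 1 ≤ V) (hu : u ∈ V) {d s₀ : ℕ}
    (hred : ∀ s ≥ s₀, ∀ w ∈ V ^ (s + 1), ∃ a ∈ V ^ s, ∃ b ∈ V ^ s, w = a + u * b)
    (hH : ∀ s ≥ s₀, finrank ℝ (V ^ (s + 1) : Submodule ℝ A) =
      finrank ℝ (V ^ s : Submodule ℝ A) + d) (s : ℕ) :
    d * s ≤ finrank ℝ (V ^ s : Submodule ℝ A) + d * d := by
  have hstep : ∀ s, finrank ℝ (gradedPiece hu s) < d →
      finrank ℝ (gradedPiece hu s) < finrank ℝ (gradedPiece hu (s + 1)) := by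
    intro s hs
    by_contra hcon
    have heq := le_antisymm (not_lt.1 hcon) (finrank_gradedPiece_le_succ hu s)
    have hconst : ∀ k, finrank ℝ (gradedPiece hu (s + k + 1)) =
        finrank ℝ (gradedPiece hu (s + k)) := by
      intro k
      induction k with
      | zero => exact heq
      | succ k ih => exact finrank_gradedPiece_stable hu (s + k) ih
    have hall : ∀ k, finrank ℝ (gradedPiece hu (s + k)) = finrank ℝ (gradedPiece hu s) := by
      intro k
      induction k with
      | zero => rfl
      | succ k ih => rw [← ih, ← hconst k]; rfl
    have := hall s₀
    rw [finrank_gradedPiece_eq hV hu hred hH (by omega : s₀ ≤ s + s₀)] at this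
    omega
  have hmin : ∀ s, min s d ≤ finrank ℝ (gradedPiece hu s) := by
    intro s
    induction s with
    | zero => simp
    | succ s ih =>
      have h1 := finrank_gradedPiece_le_succ hu s
      have h2 := hstep s
      omega
  induction s with
  | zero => simp
  | succ s ih =>
    rcases le_or_gt d s with hds | hds
    · have h1 := finrank_gradedPiece_add_le hu hV s
      have h2 := hmin s
      rw [min_eq_right hds] at h2
      rw [mul_add]
      omega
    · have : d * (s + 1) ≤ d * d := Nat.mul_le_mul_left d hds
      omega

end Growth

end Filtered

section Points

open Module Filter

variable {A : Type*} [CommRing A] [Algebra ℝ A] {V : Submodule ℝ A}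

theorem finrank_pow_add_eq {d s₀ : ℕ}
    (hH : ∀ s ≥ s₀, finrank ℝ (V ^ (s + 1) : Submodule ℝ A) =
      finrank ℝ (V ^ s : Submodule ℝ A) + d) {t : ℕ} (ht : s₀ ≤ t) (k : ℕ) :
    finrank ℝ (V ^ (t + k) : Submodule ℝ A) = finrank ℝ (V ^ t : Submodule ℝ A) + d * k := by
  induction k with
  | zero => simp
  | succ k ih =>
    rw [← add_assoc, hH (t + k) (by omega), ih]
    ring

/-- Finitely many distinct real points can be separated by elements of the algebra. -/
theorem exists_interpolation (Φ : Finset (A →ₐ[ℝ] ℝ)) (φ : A →ₐ[ℝ] ℝ) :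
    ∃ q : A, φ q = 1 ∧ ∀ ψ ∈ Φ, ψ ≠ φ → ψ q = 0 := by
  classical
  have hsep : ∀ ψ : A →ₐ[ℝ] ℝ, ∃ a : A, φ a = 1 ∧ (ψ ≠ φ → ψ a = 0) := by
    intro ψ
    by_cases h : ψ = φ
    · exact ⟨1, by simp, fun h' => absurd h h'⟩
    · obtain ⟨a, ha⟩ := DFunLike.ne_iff.1 h
      have hne : φ a - ψ a ≠ 0 := sub_ne_zero.2 (Ne.symm ha)
      refine ⟨(φ a - ψ a)⁻¹ • (a - algebraMap ℝ A (ψ a)), ?_, fun _ => ?_⟩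
      · simp [hne]
      · simp
  choose a ha hb using hsep
  refine ⟨∏ ψ ∈ Φ, a ψ, ?_, fun ψ hψ hne => ?_⟩
  · simp [map_prod, ha]
  · rw [map_prod]
    exact Finset.prod_eq_zero hψ (hb ψ hne)

/-- A Bézout bound: a nonzero element of order at most `s` has at most `d * s` real zeros. -/
theorem card_zeros_le [FiniteDimensional ℝ V] [IsDomain A] (hV : 1 ≤ V)
    (hgen : ∀ a : A, ∃ t, a ∈ V ^ t) {d s₀ : ℕ}
    (hH : ∀ s ≥ s₀, finrank ℝ (V ^ (s + 1) : Submodule ℝ A) =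
      finrank ℝ (V ^ s : Submodule ℝ A) + d) {s : ℕ} {f : A} (hf : f ∈ V ^ s) (hf0 : f ≠ 0)
    (Φ : Finset (A →ₐ[ℝ] ℝ)) (hΦ : ∀ φ ∈ Φ, φ f = 0) : Φ.card ≤ d * s := by
  classical
  choose q hq1 hq2 using exists_interpolation Φ
  choose T hT using fun φ => hgen (q φ)
  obtain ⟨t, hst, htT⟩ : ∃ t, s₀ ≤ t ∧ ∀ φ ∈ Φ, T φ ≤ t :=
    ⟨max s₀ (Φ.sup T), le_max_left _ _, fun φ hφ => (Finset.le_sup hφ).trans (le_max_right _ _)⟩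
  let ev : A →ₗ[ℝ] (Φ → ℝ) := LinearMap.pi fun φ => (φ : A →ₐ[ℝ] ℝ).toLinearMap
  have h1 := Submodule.finrank_map_add_finrank_inf_ker (V ^ (t + s)) ev
  have h2 : (V ^ (t + s)).map ev = ⊤ := by
    rw [eq_top_iff]
    intro c _
    refine ⟨∑ φ : Φ, c φ • q φ, ?_, ?_⟩
    · refine Submodule.sum_mem _ fun φ _ => Submodule.smul_mem _ _ ?_
      exact pow_mono_of_one_le hV ((htT φ φ.2).trans (Nat.le_add_right t s)) (hT φ)
    · ext ψ
      simp only [ev, LinearMap.pi_apply, AlgHom.toLinearMap_apply, map_sum, map_smul, smul_eq_mul]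
      rw [Finset.sum_eq_single ψ]
      · simp [hq1]
      · intro φ _ hne
        rw [hq2 φ ψ ψ.2 (fun h => hne (Subtype.ext h.symm)), mul_zero]
      · simp
  rw [h2, finrank_top, finrank_fintype_fun_eq_card, Fintype.card_coe,
    finrank_pow_add_eq hH hst] at h1
  have h3 : finrank ℝ (V ^ t : Submodule ℝ A) ≤
      finrank ℝ (V ^ (t + s) ⊓ LinearMap.ker ev : Submodule ℝ A) := by
    have hinj : Function.Injective (LinearMap.mulLeft ℝ f) := fun a b hab =>
      mul_left_cancel₀ hf0 hab
    rw [(Submodule.equivMapOfInjective _ hinj (V ^ t)).finrank_eq]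
    apply Submodule.finrank_mono
    rintro _ ⟨a, ha, rfl⟩
    refine ⟨?_, ?_⟩
    · rw [add_comm t s]
      exact mul_mem_pow_add hf ha
    · rw [SetLike.mem_coe, LinearMap.mem_ker]
      ext φ
      simp [ev, hΦ φ φ.2]
  omega

/-- If the real points are jointly faithful and the Hilbert function is unbounded, there are
infinitely many real points. -/
theorem infinite_points {d s₀ : ℕ} (hd : 0 < d)
    (hH : ∀ s ≥ s₀, finrank ℝ (V ^ (s + 1) : Submodule ℝ A) =
      finrank ℝ (V ^ s : Submodule ℝ A) + d)
    (hX : ∀ a : A, (∀ φ : A →ₐ[ℝ] ℝ, φ a = 0) → a = 0) : Infinite (A →ₐ[ℝ] ℝ) := by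
  by_contra hfin
  rw [not_infinite_iff_finite] at hfin
  have := Fintype.ofFinite (A →ₐ[ℝ] ℝ)
  let ev : A →ₗ[ℝ] ((A →ₐ[ℝ] ℝ) → ℝ) := LinearMap.pi fun φ => φ.toLinearMap
  have hinj : Function.Injective ev := by
    rw [injective_iff_map_eq_zero]
    intro a ha
    exact hX a fun φ => congrFun ha φ
  have hle : ∀ s, finrank ℝ (V ^ s : Submodule ℝ A) ≤ Fintype.card (A →ₐ[ℝ] ℝ) := by
    intro s
    rw [← finrank_fintype_fun_eq_card ℝ,
      (Submodule.equivMapOfInjective _ hinj (V ^ s)).finrank_eq]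
    exact Submodule.finrank_le _
  have h1 := hle (s₀ + (Fintype.card (A →ₐ[ℝ] ℝ) + 1))
  rw [finrank_pow_add_eq hH le_rfl] at h1
  nlinarith

theorem finrank_pow_le [FiniteDimensional ℝ V] [IsDomain A] (hV : 1 ≤ V)
    (hgen : ∀ a : A, ∃ t, a ∈ V ^ t) {d s₀ : ℕ} [Infinite (A →ₐ[ℝ] ℝ)]
    (hH : ∀ s ≥ s₀, finrank ℝ (V ^ (s + 1) : Submodule ℝ A) =
      finrank ℝ (V ^ s : Submodule ℝ A) + d) (s : ℕ) :
    finrank ℝ (V ^ s : Submodule ℝ A) ≤ d * s + 1 := by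
  obtain ⟨Φ, hΦ⟩ := Infinite.exists_subset_card_eq (A →ₐ[ℝ] ℝ) (d * s + 1)
  let ev : A →ₗ[ℝ] (Φ → ℝ) := LinearMap.pi fun φ => (φ : A →ₐ[ℝ] ℝ).toLinearMap
  have h1 := Submodule.finrank_map_add_finrank_inf_ker (V ^ s) ev
  have h2 : V ^ s ⊓ LinearMap.ker ev = ⊥ := by
    rw [eq_bot_iff]
    rintro f ⟨hf, hker⟩
    by_contra hf0
    have := card_zeros_le hV hgen hH hf hf0 Φ fun φ hφ => congrFun hker ⟨φ, hφ⟩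
    omega
  rw [h2, finrank_bot, add_zero] at h1
  rw [← h1, ← hΦ]
  refine (Submodule.finrank_le _).trans ?_
  simp

/-- An algebraic element of a domain with jointly faithful real points is a constant. -/
theorem exists_eq_algebraMap_of_aeval_eq_zero [IsDomain A]
    (hX : ∀ a : A, (∀ φ : A →ₐ[ℝ] ℝ, φ a = 0) → a = 0) {x : A} {q : Polynomial ℝ} (hq : q ≠ 0)
    (hqx : Polynomial.aeval x q = 0) : ∃ r : ℝ, x = algebraMap ℝ A r := by
  classical
  have h : ∏ r ∈ q.roots.toFinset, (x - algebraMap ℝ A r) = 0 := by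
    apply hX
    intro φ
    rw [map_prod]
    refine Finset.prod_eq_zero (i := φ x) ?_ (by simp)
    rw [Multiset.mem_toFinset, Polynomial.mem_roots hq, Polynomial.IsRoot.def,
      ← Polynomial.coe_aeval_eq_eval, Polynomial.aeval_algHom_apply, hqx, map_zero]
  obtain ⟨r, _, hr⟩ := Finset.prod_eq_zero_iff.1 h
  exact ⟨r, sub_eq_zero.1 hr⟩

end Points

section Reductions

open Module Filter

variable {A : Type*} [CommRing A] [Algebra ℝ A] {V : Submodule ℝ A}

theorem monomial_mem_pow {y z : A} (hy : y ∈ V) (hz : z ∈ V) (a b : ℕ) :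
    y ^ a * z ^ b ∈ V ^ (a + b) :=
  mul_mem_pow_add (Submodule.pow_mem_pow V hy a) (Submodule.pow_mem_pow V hz b)

/-- Two elements of order one satisfy a polynomial relation of bounded degree. -/
theorem exists_plane_relation [FiniteDimensional ℝ V] (hV : 1 ≤ V) {d : ℕ} (hd : 0 < d)
    (hle : ∀ s, finrank ℝ (V ^ s : Submodule ℝ A) ≤ d * s + 1) {y z : A} (hy : y ∈ V)
    (hz : z ∈ V) :
    ∃ c : Fin (2 * d + 1) × Fin (2 * d + 1) → ℝ, c ≠ 0 ∧
      ∑ i, c i • (y ^ (i.1 : ℕ) * z ^ (i.2 : ℕ)) = 0 := by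
  let v : Fin (2 * d + 1) × Fin (2 * d + 1) → (V ^ (4 * d) : Submodule ℝ A) := fun i =>
    ⟨y ^ (i.1 : ℕ) * z ^ (i.2 : ℕ), pow_mono_of_one_le hV (by omega) (monomial_mem_pow hy hz _ _)⟩
  have hdep : ¬ LinearIndependent ℝ v := by
    intro h
    have h1 := h.fintype_card_le_finrank
    have h2 := hle (4 * d)
    simp only [Fintype.card_prod, Fintype.card_fin] at h1
    nlinarith
  obtain ⟨c, hc, i, hi⟩ := Fintype.not_linearIndependent_iff.1 hdep
  refine ⟨c, fun h => hi (by simp [h]), ?_⟩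
  have := congrArg Subtype.val hc
  simpa [v, Submodule.coe_sum] using this

theorem exists_eval_top_form_ne_zero {M : ℕ} {c : Fin M × Fin M → ℝ} {i : Fin M × Fin M}
    (hi : c i ≠ 0) : ∃ r : ℝ,
      ∑ j ∈ Finset.univ.filter (fun j : Fin M × Fin M => (j.1 + j.2 : ℕ) = i.1 + i.2),
        c j * r ^ (j.2 : ℕ) ≠ 0 := by
  by_contra! h
  let q : Polynomial ℝ :=
    ∑ j ∈ Finset.univ.filter (fun j : Fin M × Fin M => (j.1 + j.2 : ℕ) = i.1 + i.2),
      Polynomial.monomial (j.2 : ℕ) (c j)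
  have hq : q = 0 := by
    apply Polynomial.funext
    intro r
    simp only [q, Polynomial.eval_finsetSum, Polynomial.eval_monomial, Polynomial.eval_zero, h r]
  have hcoeff : q.coeff (i.2 : ℕ) = c i := by
    simp only [q, Polynomial.finsetSum_coeff, Polynomial.coeff_monomial]
    rw [Finset.sum_eq_single i]
    · simp
    · intro j hj hne
      rw [if_neg]
      intro heq
      apply hne
      have := (Finset.mem_filter.1 hj).2
      ext <;> omega
    · simp
  rw [hq] at hcoeff
  exact hi (by simpa using hcoeff.symm)

theorem monomial_sub_mem {W W' : Submodule ℝ A} {y z : A} {r : ℝ} (hy : y ∈ W)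
    (hz : z ∈ W) (ht : z - r • y ∈ W') (b : ℕ) :
    ∀ a k : ℕ, a + b = k + 1 → y ^ a * z ^ b - r ^ b • y ^ (k + 1) ∈ W' * W ^ k := by
  induction b with
  | zero =>
    intro a k h
    obtain rfl : a = k + 1 := h
    simp
  | succ b ih =>
    intro a k h
    have h1 := ih (a + 1) k (by omega)
    have h2 : (z - r • y) * (y ^ a * z ^ b) ∈ W' * W ^ k := by
      apply Submodule.mul_mem_mul ht
      rw [show k = a + b by omega]
      exact monomial_mem_pow hy hz a b
    convert add_mem h2 ((W' * W ^ k).smul_mem r h1) using 1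
    simp only [Algebra.smul_def, map_pow]
    ring

theorem sup_pow_le {W W' S : Submodule ℝ A} (h : W = W' ⊔ S) (k : ℕ) :
    W ^ (k + 1) ≤ W' * W ^ k ⊔ S ^ (k + 1) := by
  induction k with
  | zero => simp [h]
  | succ k ih =>
    calc W ^ (k + 1 + 1) = (W' ⊔ S) * W ^ (k + 1) := by rw [← h, pow_succ' W (k + 1)]
      _ = W' * W ^ (k + 1) ⊔ S * W ^ (k + 1) := Submodule.sup_mul _ _ _
      _ ≤ W' * W ^ (k + 1) ⊔ S * (W' * W ^ k ⊔ S ^ (k + 1)) := by gcongr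
      _ = W' * W ^ (k + 1) ⊔ (W' * (S * W ^ k) ⊔ S ^ (k + 1 + 1)) := by
        rw [Submodule.mul_sup, pow_succ' S (k + 1), mul_left_comm]
      _ ≤ W' * W ^ (k + 1) ⊔ (W' * (W * W ^ k) ⊔ S ^ (k + 1 + 1)) := by
        gcongr
        rw [h]
        exact le_sup_right
      _ = W' * W ^ (k + 1) ⊔ S ^ (k + 1 + 1) := by
        rw [← pow_succ' W k, ← sup_assoc, sup_idem]

/-- A space of order-one elements containing `1, y, z` linearly independent, with `y, z`
algebraically dependent, has a strictly smaller reduction. -/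
theorem exists_proper_reduction [Nontrivial A] {W : Submodule ℝ A} (hW : 1 ≤ W) {y z : A}
    (hy : y ∈ W) (hz : z ∈ W) (hy1 : y ∉ Submodule.span ℝ {(1 : A)})
    (hz1 : z ∉ Submodule.span ℝ {(1 : A), y}) {M : ℕ} {c : Fin M × Fin M → ℝ} (hc : c ≠ 0)
    (hrel : ∑ i, c i • (y ^ (i.1 : ℕ) * z ^ (i.2 : ℕ)) = 0) :
    ∃ W' < W, 1 ≤ W' ∧ ∃ k, W ^ (k + 1) ≤ W' * W ^ k := by
  classical
  obtain ⟨i₀, hi₀⟩ := Function.ne_iff.1 hc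
  obtain ⟨i, hi, himax⟩ := Finset.exists_max_image
    (Finset.univ.filter fun i => c i ≠ 0) (fun i : Fin M × Fin M => (i.1 + i.2 : ℕ))
    ⟨i₀, by simpa using hi₀⟩
  have hci : c i ≠ 0 := (Finset.mem_filter.1 hi).2
  obtain ⟨r, hr⟩ := exists_eval_top_form_ne_zero hci
  have hynot : y ∉ Submodule.span ℝ {(1 : A), z - r • y} := by
    rw [Submodule.mem_span_pair]
    rintro ⟨α, β, hαβ⟩
    by_cases hβ : β = 0
    · apply hy1
      rw [Submodule.mem_span_singleton]
      exact ⟨α, by simpa [hβ] using hαβ⟩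
    · apply hz1
      rw [Submodule.mem_span_pair]
      refine ⟨-(β⁻¹ * α), β⁻¹ + r, ?_⟩
      have h1 : β⁻¹ • y = (β⁻¹ * α) • (1 : A) + (z - r • y) := by
        rw [← hαβ, smul_add, smul_smul, smul_smul, inv_mul_cancel₀ hβ, one_smul]
        simp [hαβ]
      rw [add_smul, h1, neg_smul]
      abel
  obtain ⟨F, hFy, hF⟩ := Submodule.exists_le_ker_of_notMem hynot
  have hF1 : F 1 = 0 := hF (Submodule.subset_span (by simp))
  have hFz : F (z - r • y) = 0 := hF (Submodule.subset_span (by simp))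
  have h1W : (1 : A) ∈ W := Submodule.one_le.1 hW
  set W' : Submodule ℝ A := W ⊓ LinearMap.ker F with hW'
  have h1W' : 1 ≤ W' := Submodule.one_le.2 ⟨h1W, hF1⟩
  have htW' : z - r • y ∈ W' := ⟨sub_mem hz (W.smul_mem r hy), hFz⟩
  have hsup : W = W' ⊔ Submodule.span ℝ {y} := by
    apply le_antisymm
    · intro w hw
      rw [Submodule.mem_sup]
      refine ⟨w - (F w / F y) • y, ⟨sub_mem hw (W.smul_mem _ hy), ?_⟩, (F w / F y) • y,
        Submodule.smul_mem _ _ (Submodule.mem_span_singleton_self y), by simp⟩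
      simp [hFy]
    · exact sup_le inf_le_left ((Submodule.span_singleton_le_iff_mem _ _).2 hy)
  have hle : ∀ k, W ^ k ≤ W' * W ^ k := fun k w hw => by
    simpa using Submodule.mul_mem_mul (Submodule.one_le.1 h1W') hw
  refine ⟨W', lt_of_le_of_ne inf_le_left ?_, h1W', ?_⟩
  · intro h
    rw [← h] at hy
    exact hFy hy.2
  obtain ⟨k, hk⟩ : ∃ k, (i.1 + i.2 : ℕ) = k + 1 := by
    apply Nat.exists_eq_succ_of_ne_zero
    intro h0
    have hrel' : c i • (1 : A) = 0 := by
      rw [← hrel, Finset.sum_eq_single i]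
      · rw [show (i.1 : ℕ) = 0 by omega, show (i.2 : ℕ) = 0 by omega]
        simp
      · intro j _ hj
        by_contra hne
        have hcj : c j ≠ 0 := fun h => hne (by simp [h])
        have := himax j (by simpa using hcj)
        apply hj
        ext <;> omega
      · simp
    rcases smul_eq_zero.1 hrel' with h | h
    · exact hci h
    · exact one_ne_zero h
  refine ⟨k, (sup_pow_le hsup k).trans (sup_le le_rfl ?_)⟩
  rw [Submodule.span_pow, Set.singleton_pow, Submodule.span_singleton_le_iff_mem]
  rw [hk] at hr
  set q := ∑ j ∈ Finset.univ.filter (fun j : Fin M × Fin M => (j.1 + j.2 : ℕ) = k + 1),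
        c j * r ^ (j.2 : ℕ) with hq
  have hqy : q • y ^ (k + 1) ∈ W' * W ^ k := by
    have h1 : ∑ j : Fin M × Fin M, (c j • (y ^ (j.1 : ℕ) * z ^ (j.2 : ℕ)) -
        if (j.1 + j.2 : ℕ) = k + 1 then (c j * r ^ (j.2 : ℕ)) • y ^ (k + 1) else 0) ∈
          W' * W ^ k := by
      refine Submodule.sum_mem _ fun j _ => ?_
      split_ifs with hj
      · rw [mul_smul, ← smul_sub]
        exact Submodule.smul_mem _ _ (monomial_sub_mem hy hz htW' _ _ _ hj)
      · rw [sub_zero]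
        by_cases hcj : c j = 0
        · simp [hcj]
        · apply Submodule.smul_mem
          apply hle
          have := himax j (by simpa using hcj)
          exact pow_mono_of_one_le hW (by omega) (monomial_mem_pow hy hz _ _)
    rw [Finset.sum_sub_distrib, hrel, zero_sub, neg_mem_iff, ← Finset.sum_filter,
      ← Finset.sum_smul] at h1
    exact h1
  have := (W' * W ^ k).smul_mem q⁻¹ hqy
  rwa [smul_smul, inv_mul_cancel₀ hr, one_smul] at this

theorem pow_add_le_of_reduction {W : Submodule ℝ A} {s : ℕ}
    (h : V ^ (s + 1) ≤ W * V ^ s) (j : ℕ) : V ^ (s + j) ≤ W ^ j * V ^ s := by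
  induction j with
  | zero => simp
  | succ j ih =>
    calc V ^ (s + (j + 1)) = V * V ^ (s + j) := by rw [← add_assoc, pow_succ']
      _ ≤ V * (W ^ j * V ^ s) := by gcongr
      _ = W ^ j * V ^ (s + 1) := by rw [pow_succ' V s, mul_left_comm]
      _ ≤ W ^ j * (W * V ^ s) := by gcongr
      _ = W ^ (j + 1) * V ^ s := by rw [pow_succ, mul_assoc]

theorem exists_reduction_le_pair [Nontrivial A] [FiniteDimensional ℝ V] (hV : 1 ≤ V) {d : ℕ}
    (hd : 0 < d) (hle : ∀ s, finrank ℝ (V ^ s : Submodule ℝ A) ≤ d * s + 1) :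
    ∀ m : ℕ, ∀ W ≤ V, finrank ℝ W ≤ m → 1 ≤ W → (∃ s, V ^ (s + 1) ≤ W * V ^ s) →
      ∃ u ∈ V, ∃ s, V ^ (s + 1) ≤ Submodule.span ℝ {1, u} * V ^ s := by
  intro m
  induction m with
  | zero =>
    intro W hWV hfin hW _
    have : FiniteDimensional ℝ W := Submodule.finiteDimensional_of_le hWV
    rw [Nat.le_zero, Submodule.finrank_eq_zero] at hfin
    rw [hfin, Submodule.one_le] at hW
    exact absurd hW (by simp)
  | succ m ih =>
    rintro W hWV hfin hW ⟨s, hs⟩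
    have : FiniteDimensional ℝ W := Submodule.finiteDimensional_of_le hWV
    by_cases hpair : ∃ u ∈ V, W ≤ Submodule.span ℝ {1, u}
    · obtain ⟨u, hu, hWu⟩ := hpair
      exact ⟨u, hu, s, hs.trans (by gcongr)⟩
    push Not at hpair
    obtain ⟨y, hyW, hy⟩ := SetLike.not_le_iff_exists.1 (hpair 0 (zero_mem V))
    obtain ⟨z, hzW, hz⟩ := SetLike.not_le_iff_exists.1 (hpair y (hWV hyW))
    have hy1 : y ∉ Submodule.span ℝ {(1 : A)} := fun h =>
      hy (Submodule.span_mono (by simp) h)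
    obtain ⟨c, hc, hrel⟩ := exists_plane_relation hV hd hle (hWV hyW) (hWV hzW)
    obtain ⟨W', hW'W, h1W', k, hk⟩ := exists_proper_reduction hW hyW hzW hy1 hz hc hrel
    have hlt := Submodule.finrank_lt_finrank_of_lt hW'W
    refine ih W' (hW'W.le.trans hWV) (by omega) h1W' ⟨s + k, ?_⟩
    calc V ^ (s + k + 1) ≤ W ^ (k + 1) * V ^ s := pow_add_le_of_reduction hs (k + 1)
      _ ≤ W' * W ^ k * V ^ s := by gcongr
      _ ≤ W' * V ^ k * V ^ s := by gcongr
      _ = W' * V ^ (s + k) := by rw [mul_assoc, ← pow_add, add_comm k s]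

/-- The uniform linear lower bound for the Hilbert function of a real affine curve. -/
theorem mul_le_finrank_pow_add_sq [Nontrivial A] [FiniteDimensional ℝ V] (hV : 1 ≤ V) {d s₀ : ℕ}
    (hd : 0 < d) (hle : ∀ s, finrank ℝ (V ^ s : Submodule ℝ A) ≤ d * s + 1)
    (hH : ∀ s ≥ s₀, finrank ℝ (V ^ (s + 1) : Submodule ℝ A) =
      finrank ℝ (V ^ s : Submodule ℝ A) + d) (s : ℕ) :
    d * s ≤ finrank ℝ (V ^ s : Submodule ℝ A) + d * d := by
  obtain ⟨u, hu, s₁, hs₁⟩ := exists_reduction_le_pair hV hd hle _ V le_rfl le_rfl hV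
    ⟨0, by simp⟩
  refine mul_le_finrank_pow_add (s₀ := s₀ + s₁) hV hu ?_ (fun s hs => hH s (by omega)) s
  intro s hs w hw
  obtain ⟨k, rfl⟩ : ∃ k, s = s₁ + k := ⟨s - s₁, by omega⟩
  have h1 : V ^ (s₁ + k + 1) ≤ Submodule.span ℝ {1, u} * V ^ (s₁ + k) :=
    calc V ^ (s₁ + k + 1) = V ^ k * V ^ (s₁ + 1) := by rw [← pow_add]; congr 1; ring
      _ ≤ V ^ k * (Submodule.span ℝ {1, u} * V ^ s₁) := by gcongr
      _ = Submodule.span ℝ {1, u} * V ^ (s₁ + k) := by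
        rw [mul_left_comm, ← pow_add, add_comm k s₁]
  have h2 := h1 hw
  rw [Submodule.span_insert, Submodule.sup_mul, Submodule.mem_sup] at h2
  obtain ⟨a, ha, b, hb, rfl⟩ := h2
  obtain ⟨a', ha', rfl⟩ := Submodule.mem_span_singleton_mul.1 ha
  obtain ⟨b', hb', rfl⟩ := Submodule.mem_span_singleton_mul.1 hb
  exact ⟨a', ha', b', hb', by simp⟩

end Reductions

section PlaneRelations

/-- The value at `(y, z)` of the bivariate polynomial with coefficients `c`. -/
def planeEval {S : Type*} [CommRing S] {M N : ℕ} (c : Fin M × Fin N → S) (y z : S) : S :=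
  ∑ i, c i * (y ^ (i.1 : ℕ) * z ^ (i.2 : ℕ))

/-- The value at `(y, z)` of the partial derivative, with respect to the second variable, of the
bivariate polynomial with coefficients `c`. -/
def planeDeriv {S : Type*} [CommRing S] {M N : ℕ} (c : Fin M × Fin N → S) (y z : S) : S :=
  ∑ i, c i * (y ^ (i.1 : ℕ) * ((i.2 : ℕ) * z ^ ((i.2 : ℕ) - 1)))

theorem map_planeEval {S T : Type*} [CommRing S] [CommRing T] (f : S →+* T) {M N : ℕ}
    (c : Fin M × Fin N → S) (y z : S) :
    f (planeEval c y z) = planeEval (fun i => f (c i)) (f y) (f z) := by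
  simp [planeEval, map_sum]

theorem map_planeDeriv {S T : Type*} [CommRing S] [CommRing T] (f : S →+* T) {M N : ℕ}
    (c : Fin M × Fin N → S) (y z : S) :
    f (planeDeriv c y z) = planeDeriv (fun i => f (c i)) (f y) (f z) := by
  simp [planeDeriv, map_sum]

/-- Taylor expansion to first order in the second variable. -/
theorem exists_planeEval_add {S : Type*} [CommRing S] {M N : ℕ} (c : Fin M × Fin N → S)
    (y z h : S) :
    ∃ k, planeEval c y (z + h) = planeEval c y z + planeDeriv c y z * h + k * h ^ 2 := by
  refine ⟨∑ i, c i * (y ^ (i.1 : ℕ) * (Polynomial.powAddExpansion z h (i.2 : ℕ)).1), ?_⟩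
  simp only [planeEval, planeDeriv, Finset.sum_mul, ← Finset.sum_add_distrib]
  refine Finset.sum_congr rfl fun i _ => ?_
  linear_combination (c i * y ^ (i.1 : ℕ)) * (Polynomial.powAddExpansion z h (i.2 : ℕ)).2

theorem planeDeriv_succ {S : Type*} [CommRing S] {M r : ℕ} (c : Fin M × Fin (r + 2) → S)
    (y z : S) :
    planeDeriv c y z =
      planeEval (fun i : Fin M × Fin (r + 1) => c (i.1, i.2.succ) * ((i.2 : ℕ) + 1)) y z := by
  simp only [planeDeriv, planeEval, Fintype.sum_prod_type]
  refine Finset.sum_congr rfl fun a _ => ?_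
  rw [Fin.sum_univ_succ]
  simp only [Fin.val_zero, Nat.cast_zero, zero_mul, mul_zero, zero_add, Fin.val_succ,
    Nat.add_sub_cancel, Nat.cast_add, Nat.cast_one]
  refine Finset.sum_congr rfl fun b _ => ?_
  ring

open Module

variable {A : Type*} [CommRing A] [Algebra ℝ A]

theorem coeff_eq_zero_of_planeEval_eq_zero {M r : ℕ} {c : Fin M × Fin (r + 1) → ℝ} {y z : A}
    (hy : ∀ q : Polynomial ℝ, q ≠ 0 → Polynomial.aeval y q ≠ 0)
    (hc : ∀ a b, c (a, Fin.succ b) = 0)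
    (hrel : planeEval (fun i => algebraMap ℝ A (c i)) y z = 0) : c = 0 := by
  let q : Polynomial ℝ := ∑ a : Fin M, Polynomial.monomial (a : ℕ) (c (a, 0))
  have hq : q = 0 := by
    by_contra hne
    apply hy q hne
    rw [← hrel]
    simp only [q, planeEval, map_sum, Polynomial.aeval_monomial, Fintype.sum_prod_type]
    refine Finset.sum_congr rfl fun a _ => ?_
    rw [Fin.sum_univ_succ]
    simp [hc]
  funext ⟨a, b⟩
  refine Fin.cases ?_ (fun b => hc a b) b
  have hcoeff : q.coeff (a : ℕ) = c (a, 0) := by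
    simp only [q, Polynomial.finsetSum_coeff, Polynomial.coeff_monomial]
    rw [Finset.sum_eq_single a]
    · simp
    · intro a' _ hne
      rw [if_neg (fun h => hne (Fin.ext h))]
    · simp
  rw [← hcoeff, hq]
  simp

/-- A plane relation of minimal degree in the second variable: all relations in the same degree
box are separable in the second variable. -/
theorem exists_separable_plane_relation {d : ℕ} {y z : A}
    (hex : ∃ c : Fin (2 * d + 1) × Fin (2 * d + 1) → ℝ, c ≠ 0 ∧
      planeEval (fun i => algebraMap ℝ A (c i)) y z = 0)
    (hy : ∀ q : Polynomial ℝ, q ≠ 0 → Polynomial.aeval y q ≠ 0) :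
    ∃ r ≤ 2 * d, (∃ c : Fin (2 * d + 1) × Fin (r + 1) → ℝ, c ≠ 0 ∧
        planeEval (fun i => algebraMap ℝ A (c i)) y z = 0) ∧
      ∀ c : Fin (2 * d + 1) × Fin (r + 1) → ℝ, c ≠ 0 →
        planeEval (fun i => algebraMap ℝ A (c i)) y z = 0 →
        planeDeriv (fun i => algebraMap ℝ A (c i)) y z ≠ 0 := by
  classical
  have hex' : ∃ r, ∃ c : Fin (2 * d + 1) × Fin (r + 1) → ℝ, c ≠ 0 ∧
      planeEval (fun i => algebraMap ℝ A (c i)) y z = 0 := ⟨2 * d, hex⟩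
  refine ⟨Nat.find hex', Nat.find_min' hex' hex, Nat.find_spec hex', ?_⟩
  have hmin : ∀ m < Nat.find hex', _ := fun m hm => Nat.find_min hex' hm
  generalize Nat.find hex' = r at hmin
  intro c hc hrel hderiv
  apply hc
  refine coeff_eq_zero_of_planeEval_eq_zero hy ?_ hrel
  rcases r with - | r
  · intro a b
    exact b.elim0
  · intro a b
    rw [planeDeriv_succ] at hderiv
    by_contra hne
    refine hmin r (by omega) ⟨fun i => c (i.1, i.2.succ) * ((i.2 : ℕ) + 1), ?_, ?_⟩
    · intro h0
      have := congrFun h0 (a, b)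
      simp only [Pi.zero_apply, mul_eq_zero, hne, false_or] at this
      exact absurd this (by positivity)
    · simpa using hderiv

end PlaneRelations

section Monomials

open Module

variable {A : Type*} [CommRing A] [Algebra ℝ A] {n : ℕ}

/-- The space of polynomials of degree at most one in the generators `x`. -/
def linSpan (x : Fin n → A) : Submodule ℝ A := Submodule.span ℝ (insert 1 (Set.range x))

theorem one_le_linSpan (x : Fin n → A) : 1 ≤ linSpan x :=
  Submodule.one_le.2 (Submodule.subset_span (by simp))

theorem mem_linSpan (x : Fin n → A) (i : Fin n) : x i ∈ linSpan x :=
  Submodule.subset_span (by simp)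

instance (x : Fin n → A) : FiniteDimensional ℝ (linSpan x) :=
  FiniteDimensional.span_of_finite ℝ ((Set.finite_range x).insert 1)

theorem prod_pow_mem_linSpan_pow (x : Fin n → A) (α : Fin n → ℕ) :
    ∏ i, x i ^ α i ∈ linSpan x ^ (∑ i, α i) := by
  induction (Finset.univ : Finset (Fin n)) using Finset.cons_induction with
  | empty => simpa using ⟨1, map_one _⟩
  | cons i s hi ih =>
    rw [Finset.prod_cons, Finset.sum_cons]
    exact mul_mem_pow_add (Submodule.pow_mem_pow _ (mem_linSpan x i) _) ih

theorem linSpan_pow_eq (x : Fin n → A) (s : ℕ) :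
    linSpan x ^ s =
      Submodule.span ℝ ((fun α : Fin n → ℕ => ∏ i, x i ^ α i) '' {α | ∑ i, α i ≤ s}) := by
  apply le_antisymm
  · induction s with
    | zero =>
      rw [pow_zero, Submodule.one_le]
      exact Submodule.subset_span ⟨0, by simp, by simp⟩
    | succ s ih =>
      rw [pow_succ']
      refine (mul_le_mul_right ih _).trans ?_
      rw [linSpan, Submodule.span_mul_span, Submodule.span_le]
      rintro _ ⟨a, ha, _, ⟨α, hα, rfl⟩, rfl⟩
      rcases ha with rfl | ⟨i, rfl⟩
      · exact Submodule.subset_span ⟨α, Nat.le_succ_of_le hα, by simp⟩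
      · refine Submodule.subset_span ⟨α + Pi.single i 1, ?_, ?_⟩
        · simpa [Finset.sum_add_distrib, Finset.sum_pi_single'] using hα
        · simp only [Pi.add_apply, pow_add, Finset.prod_mul_distrib]
          rw [mul_comm, Finset.prod_eq_single (a := i)
            (f := fun j => x j ^ (Pi.single i 1 : Fin n → ℕ) j)]
          · simp
          · intro j _ hj
            simp [hj]
          · simp
  · rw [Submodule.span_le]
    rintro _ ⟨α, hα, rfl⟩
    exact pow_mono_of_one_le (one_le_linSpan x) hα (prod_pow_mem_linSpan_pow x α)

/-- A set of monomials adapted to the degree filtration. -/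
theorem exists_adapted_monomials (x : Fin n → A) (D : ℕ) :
    ∃ E : Finset (Fin n → ℕ), (∀ α ∈ E, ∑ i, α i ≤ D) ∧
      LinearIndepOn ℝ (fun α : Fin n → ℕ => ∏ i, x i ^ α i) (E : Set (Fin n → ℕ)) ∧
      E.card = finrank ℝ (linSpan x ^ D : Submodule ℝ A) ∧
      ∑ α ∈ E, ∑ i, α i + ∑ j ∈ Finset.range D, finrank ℝ (linSpan x ^ j : Submodule ℝ A) ≤
        D * finrank ℝ (linSpan x ^ D : Submodule ℝ A) := by
  classical
  have key : ∀ (D : ℕ) (E₀ : Finset (Fin n → ℕ)), (∀ α ∈ E₀, ∑ i, α i ≤ D) →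
      LinearIndepOn ℝ (fun α : Fin n → ℕ => ∏ i, x i ^ α i) (E₀ : Set (Fin n → ℕ)) →
      ∃ E : Finset (Fin n → ℕ), E₀ ⊆ E ∧ (∀ α ∈ E, ∑ i, α i ≤ D) ∧
      LinearIndepOn ℝ (fun α : Fin n → ℕ => ∏ i, x i ^ α i) (E : Set (Fin n → ℕ)) ∧
      E.card = finrank ℝ (linSpan x ^ D : Submodule ℝ A) := by
    intro D E₀ hdeg hli
    obtain ⟨b, hbt, hsb, htb, hb⟩ := exists_linearIndepOn_extension hli
      (t := {α : Fin n → ℕ | ∑ i, α i ≤ D}) hdeg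
    have hspan : Submodule.span ℝ ((fun α : Fin n → ℕ => ∏ i, x i ^ α i) '' b) =
        linSpan x ^ D := by
      rw [linSpan_pow_eq]
      exact le_antisymm (Submodule.span_mono (Set.image_mono hbt)) (Submodule.span_le.2 htb)
    have hfin : b.Finite := by
      refine Set.Finite.subset (Set.Finite.pi' fun _ : Fin n => Set.finite_le_nat D) ?_
      intro α hα i
      exact (Finset.single_le_sum (f := α) (fun _ _ => Nat.zero_le _) (Finset.mem_univ i)).trans
        (hbt hα)
    refine ⟨hfin.toFinset, ?_, ?_, by simpa using hb, ?_⟩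
    · intro α hα
      simpa using hsb hα
    · intro α hα
      exact hbt (by simpa using hα)
    · have := hfin.fintype
      rw [← hspan, Set.image_eq_range, finrank_span_eq_card hb, ← Set.toFinset_card]
      congr 1
      ext
      simp
  induction D with
  | zero =>
    obtain ⟨E, -, h1, h2, h3⟩ := key 0 ∅ (by simp) (by simp)
    refine ⟨E, h1, h2, h3, ?_⟩
    simp only [Finset.range_zero, Finset.sum_empty, add_zero, zero_mul, Nat.le_zero]
    exact Finset.sum_eq_zero fun α hα => Nat.le_zero.1 (h1 α hα)
  | succ D ih =>
    obtain ⟨E₀, h1, h2, h3, h4⟩ := ih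
    obtain ⟨E, hE, h1', h2', h3'⟩ := key (D + 1) E₀ (fun α hα => (h1 α hα).trans (by omega)) h2
    refine ⟨E, h1', h2', h3', ?_⟩
    have h5 : ∑ α ∈ E \ E₀, ∑ i, α i ≤ (E \ E₀).card * (D + 1) :=
      Finset.sum_le_card_nsmul _ _ _ fun α hα => h1' α (Finset.mem_sdiff.1 hα).1
    have h6 := Finset.sum_sdiff (f := fun α : Fin n → ℕ => ∑ i, α i) hE
    have h7 := Finset.card_sdiff_add_card_eq_card hE
    rw [Finset.sum_range_succ, ← h3', ← h3]
    rw [← h3] at h4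
    nlinarith

end Monomials

section SmallRelations

attribute [local instance] Matrix.seminormedAddCommGroup

/-- A homogeneous linear system with bounded integer coefficients and a nonzero real solution has
a nonzero integer solution of bounded size. -/
theorem exists_int_solution {ι κ : Type*} [Fintype ι] (Z : Finset κ) (v : κ → ι → ℤ) {c : ι → ℝ}
    (hc : c ≠ 0) (hcv : ∀ k ∈ Z, ∑ i, c i * v k i = 0) {R : ℝ} (hR : 1 ≤ R)
    (hv : ∀ k ∈ Z, ∀ i, |(v k i : ℝ)| ≤ R) :
    ∃ t : ι → ℤ, t ≠ 0 ∧ (∀ k ∈ Z, ∑ i, t i * v k i = 0) ∧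
      ∀ i, |(t i : ℝ)| ≤ (Fintype.card ι * R) ^ Fintype.card ι := by
  classical
  let v' : κ → ι → ℝ := fun k i => v k i
  obtain ⟨b, hbZ, -, hspan, hb⟩ := exists_linearIndepOn_extension (v := v')
    (linearIndepOn_empty ℝ v') (Set.empty_subset (Z : Set κ))
  have hbfin : b.Finite := Z.finite_toSet.subset hbZ
  have := hbfin.fintype
  obtain ⟨i₀, hi₀⟩ := Function.ne_iff.1 hc
  let L : (ι → ℝ) → ((ι → ℝ) →ₗ[ℝ] ℝ) := fun t => ∑ i, t i • LinearMap.proj i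
  have hL : ∀ t w, L t w = ∑ i, t i * w i := fun t w => by simp [L]
  have hcard : Fintype.card b < Fintype.card ι := by
    rw [← finrank_span_eq_card hb, ← Module.finrank_fintype_fun_eq_card (R := ℝ) (η := ι)]
    refine Submodule.finrank_lt fun htop => hi₀ ?_
    have hker : Submodule.span ℝ (Set.range fun k : b => v' k) ≤ LinearMap.ker (L c) := by
      rw [Submodule.span_le]
      rintro _ ⟨k, rfl⟩
      rw [SetLike.mem_coe, LinearMap.mem_ker, hL]
      exact hcv k (hbZ k.2)
    rw [htop] at hker
    have := hker (Submodule.mem_top (x := Pi.single i₀ 1))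
    rw [LinearMap.mem_ker, hL, Finset.sum_eq_single i₀] at this
    · simpa using this
    · intro i _ hi
      simp [hi]
    · simp
  have hι : (1 : ℝ) ≤ Fintype.card ι := by
    exact_mod_cast Nat.one_le_iff_ne_zero.2 (by omega)
  have hlift : ∀ t : ι → ℤ, (∀ k ∈ b, ∑ i, t i * v k i = 0) → ∀ k ∈ Z, ∑ i, t i * v k i = 0 := by
    intro t ht k hk
    have hker : Submodule.span ℝ (v' '' b) ≤ LinearMap.ker (L fun i => t i) := by
      rw [Submodule.span_le]
      rintro _ ⟨k, hk, rfl⟩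
      rw [SetLike.mem_coe, LinearMap.mem_ker, hL]
      simp only [v']
      exact_mod_cast ht k hk
    have := hker (hspan ⟨k, hk, rfl⟩)
    rw [LinearMap.mem_ker, hL] at this
    simp only [v'] at this
    exact_mod_cast this
  rcases Nat.eq_zero_or_pos (Fintype.card b) with h0 | hpos
  · refine ⟨Pi.single i₀ 1, by simp, hlift _ fun k hk => ?_, fun i => ?_⟩
    · exact ((Fintype.card_eq_zero_iff.1 h0).false ⟨k, hk⟩).elim
    · have h1 : |((Pi.single i₀ 1 : ι → ℤ) i : ℝ)| ≤ 1 := by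
        by_cases h : i = i₀
        · subst h
          simp
        · simp [h]
      exact h1.trans (one_le_pow₀ (one_le_mul_of_one_le_of_one_le hι hR))
  · obtain ⟨t, ht0, ht, hnorm⟩ := Int.Matrix.exists_ne_zero_int_vec_norm_le
      (Matrix.of fun (k : b) i => v k i) hcard hpos
    refine ⟨t, ht0, hlift t fun k hk => ?_, fun i => ?_⟩
    · have := congrFun ht ⟨k, hk⟩
      simpa [Matrix.mulVec, dotProduct, mul_comm] using this
    · have h1 : |(t i : ℝ)| ≤ ‖t‖ := by
        simpa [Int.norm_eq_abs] using norm_le_pi_norm t i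
      have hA : ‖Matrix.of fun (k : b) i => v k i‖ ≤ R := by
        rw [Matrix.norm_le_iff (by linarith)]
        intro k i
        simpa [Int.norm_eq_abs] using hv k (hbZ k.2) i
      refine h1.trans (hnorm.trans ?_)
      have hm : max 1 ‖Matrix.of fun (k : b) i => v k i‖ ≤ R := max_le hR hA
      have hbase : (1 : ℝ) ≤ Fintype.card ι * max 1 ‖Matrix.of fun (k : b) i => v k i‖ :=
        one_le_mul_of_one_le_of_one_le hι (le_max_left _ _)
      have hc1 : (Fintype.card b : ℝ) + 1 ≤ Fintype.card ι := by exact_mod_cast hcard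
      have hexp : (Fintype.card b : ℝ) / (Fintype.card ι - Fintype.card b) ≤ Fintype.card ι := by
        rw [div_le_iff₀ (by linarith)]
        nlinarith
      calc _ ≤ (Fintype.card ι * max 1 ‖Matrix.of fun (k : b) i => v k i‖) ^
            (Fintype.card ι : ℝ) := Real.rpow_le_rpow_of_exponent_le hbase hexp
        _ = (Fintype.card ι * max 1 ‖Matrix.of fun (k : b) i => v k i‖) ^ Fintype.card ι :=
            Real.rpow_natCast _ _
        _ ≤ _ := by gcongr

end SmallRelations

section Congruences

open Polynomial

/-- Hensel lifting: along a smooth residue class of a plane curve, the second coordinate is a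
polynomial in the first one modulo any power of the prime. -/
theorem exists_hensel_polynomial {M N : ℕ} (c : Fin M × Fin N → ℤ) (p a b w : ℤ)
    (hw : p ∣ w * planeDeriv c a b - 1) (k : ℕ) :
    ∃ g : ℤ[X], ∀ y z : ℤ, p ∣ y - a → p ∣ z - b → planeEval c y z = 0 →
      p ^ (k + 1) ∣ z - g.eval (y - a) := by
  induction k with
  | zero => exact ⟨C b, fun y z _ hz _ => by simpa using hz⟩
  | succ k ih =>
    obtain ⟨g, hg⟩ := ih
    refine ⟨g - C w * planeEval (fun i => C (c i)) (C a + X) g, fun y z hy hz hyz => ?_⟩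
    have heval : (planeEval (fun i => C (c i)) (C a + X) g).eval (y - a) =
        planeEval c y (g.eval (y - a)) := by
      have := map_planeEval (evalRingHom (y - a)) (fun i => C (c i)) (C a + X) g
      simpa using this
    obtain ⟨h, hh⟩ := hg y z hy hz hyz
    set G := g.eval (y - a) with hG
    obtain ⟨m, hm⟩ := exists_planeEval_add c y G (p ^ (k + 1) * h)
    have hzG : z = G + p ^ (k + 1) * h := by linarith
    have hGb : p ∣ G - b := by
      have : G - b = (z - b) - p * (p ^ k * h) := by rw [hzG]; ring
      rw [this]
      exact dvd_sub hz (dvd_mul_right _ _)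
    have hderiv : p ∣ planeDeriv c y G - planeDeriv c a b := by
      rw [planeDeriv, planeDeriv, ← Finset.sum_sub_distrib]
      refine Finset.dvd_sum fun i _ => ?_
      have h1 : p ∣ y ^ (i.1 : ℕ) - a ^ (i.1 : ℕ) := hy.trans (sub_dvd_pow_sub_pow _ _ _)
      have h2 : p ∣ G ^ ((i.2 : ℕ) - 1) - b ^ ((i.2 : ℕ) - 1) :=
        hGb.trans (sub_dvd_pow_sub_pow _ _ _)
      obtain ⟨e1, h1⟩ := h1
      obtain ⟨e2, h2⟩ := h2
      exact ⟨c i * (i.2 : ℕ) * (e1 * G ^ ((i.2 : ℕ) - 1) + a ^ (i.1 : ℕ) * e2), by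
        linear_combination (c i * (i.2 : ℕ)) * (G ^ ((i.2 : ℕ) - 1) * h1 + a ^ (i.1 : ℕ) * h2)⟩
    rw [← hzG, hyz] at hm
    obtain ⟨e, he⟩ := hderiv
    obtain ⟨f, hf⟩ := hw
    rw [eval_sub, eval_mul, eval_C, heval, ← hG]
    refine ⟨-h * (f + w * e) - w * m * p ^ k * h ^ 2, ?_⟩
    linear_combination hzG - w * hm - p ^ (k + 1) * h * (w * he + hf)

/-- Pigeonhole: a small nontrivial integer combination of polynomials that is highly divisible on
a residue class. -/
theorem exists_small_combination {ι : Type*} [Fintype ι] (G : ι → ℤ[X]) (m : ι → ℕ) (p s : ℕ)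
    (hp : 0 < p) (hcard : ∏ j : Fin s, p ^ (s - j) < ∏ i, (m i + 1)) :
    ∃ h : ι → ℤ, h ≠ 0 ∧ (∀ i, |h i| ≤ m i) ∧
      ∀ t : ℤ, (p : ℤ) ∣ t → (p : ℤ) ^ s ∣ ∑ i, h i * (G i).eval t := by
  classical
  have : NeZero p := ⟨hp.ne'⟩
  let F : (∀ i, Fin (m i + 1)) → ∀ j : Fin s, ZMod (p ^ (s - j)) := fun c j =>
    (((∑ i, C ((c i : ℕ) : ℤ) * G i).coeff j : ℤ) : ZMod (p ^ (s - j)))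
  obtain ⟨c, c', hne, hF⟩ := Fintype.exists_ne_map_eq_of_card_lt F (by
    simpa [Fintype.card_pi, ZMod.card] using hcard)
  refine ⟨fun i => ((c i : ℕ) : ℤ) - ((c' i : ℕ) : ℤ), ?_, fun i => ?_, fun t ht => ?_⟩
  · intro h0
    apply hne
    funext i
    have := congrFun h0 i
    simp only [Pi.zero_apply] at this
    exact Fin.ext (by omega)
  · have h1 := (c i).2
    have h2 := (c' i).2
    dsimp only
    rw [abs_le]
    constructor <;> omega
  · let Q : ℤ[X] := ∑ i, C ((c i : ℕ) : ℤ) * G i - ∑ i, C ((c' i : ℕ) : ℤ) * G i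
    have hQ : ∑ i, (((c i : ℕ) : ℤ) - ((c' i : ℕ) : ℤ)) * (G i).eval t = Q.eval t := by
      simp [Q, eval_finsetSum, sub_mul, Finset.sum_sub_distrib]
    rw [hQ, eval_eq_sum_range]
    refine Finset.dvd_sum fun j _ => ?_
    rcases lt_or_ge j s with hj | hj
    · have h1 : ((p ^ (s - j) : ℕ) : ℤ) ∣ Q.coeff j := by
        have := congrFun hF ⟨j, hj⟩
        rw [← ZMod.intCast_zmod_eq_zero_iff_dvd, coeff_sub, Int.cast_sub, sub_eq_zero]
        exact this
      have h2 : (p : ℤ) ^ s = ((p ^ (s - j) : ℕ) : ℤ) * (p : ℤ) ^ j := by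
        push_cast
        rw [← pow_add, Nat.sub_add_cancel hj.le]
      rw [h2]
      exact mul_dvd_mul h1 (pow_dvd_pow_of_dvd ht j)
    · exact Dvd.dvd.mul_left ((pow_dvd_pow _ hj).trans (pow_dvd_pow_of_dvd ht j)) _

theorem card_smooth_fiber_le {F : Type*} [Field F] [Fintype F] [DecidableEq F] {M r : ℕ}
    (c : Fin M × Fin (r + 1) → F) (u : F) :
    (Finset.univ.filter fun v => planeEval c u v = 0 ∧ planeDeriv c u v ≠ 0).card ≤ r := by
  classical
  let Q : F[X] := ∑ i, C (c i * u ^ (i.1 : ℕ)) * X ^ (i.2 : ℕ)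
  have hQ : ∀ v, Q.eval v = planeEval c u v := fun v => by
    simp [Q, planeEval, eval_finsetSum, mul_assoc]
  have hQ' : ∀ v, Q.derivative.eval v = planeDeriv c u v := fun v => by
    simp only [Q, planeDeriv, derivative_sum, eval_finsetSum, derivative_C_mul_X_pow, eval_C_mul,
      eval_pow, eval_X]
    exact Finset.sum_congr rfl fun i _ => by ring
  rcases Finset.eq_empty_or_nonempty
    (Finset.univ.filter fun v => planeEval c u v = 0 ∧ planeDeriv c u v ≠ 0) with h | ⟨v₀, hv₀⟩
  · simp [h]
  · have hQ0 : Q ≠ 0 := by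
      intro h0
      apply (Finset.mem_filter.1 hv₀).2.2
      rw [← hQ', h0]
      simp
    have hdeg : Q.natDegree ≤ r := by
      refine natDegree_sum_le_of_forall_le _ _ fun i _ => ?_
      exact (natDegree_C_mul_X_pow_le _ _).trans (Nat.lt_succ_iff.1 i.2.2)
    refine (Finset.card_le_card (t := Q.roots.toFinset) fun v hv => ?_).trans
      ((Multiset.toFinset_card_le _).trans ((card_roots' Q).trans hdeg))
    rw [Multiset.mem_toFinset, mem_roots hQ0, IsRoot.def, hQ]
    exact (Finset.mem_filter.1 hv).2.1

theorem exists_primes_in_range (N : ℕ) (hN : N ≠ 0) (k : ℕ) :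
    ∃ T : Finset ℕ, T.card = k ∧ ∀ p ∈ T, p.Prime ∧ N < p ∧ p ≤ 2 ^ k * N := by
  induction k with
  | zero => exact ⟨∅, by simp⟩
  | succ k ih =>
    obtain ⟨T, hT, hTp⟩ := ih
    obtain ⟨p, hp, h1, h2⟩ := Nat.exists_prime_lt_and_le_two_mul (2 ^ k * N) (by positivity)
    have hpT : p ∉ T := fun h => by have := (hTp p h).2.2; omega
    have hNk : N ≤ 2 ^ k * N := Nat.le_mul_of_pos_left _ (by positivity)
    refine ⟨Finset.cons p T hpT, by rw [Finset.card_cons, hT], fun q hq => ?_⟩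
    rw [pow_succ]
    rcases Finset.mem_cons.1 hq with rfl | hq
    · exact ⟨hp, by omega, by linarith⟩
    · obtain ⟨h3, h4, h5⟩ := hTp q hq
      exact ⟨h3, h4, by linarith⟩

/-- A nonzero integer is not divisible by all primes of a large set. -/
theorem exists_prime_not_dvd {N : ℕ} {T : Finset ℕ} (hT : ∀ p ∈ T, p.Prime ∧ N < p)
    (hT0 : T.Nonempty) {Δ : ℤ} (hΔ : Δ ≠ 0) (hle : |Δ| ≤ (N : ℤ) ^ T.card) :
    ∃ p ∈ T, ¬ (p : ℤ) ∣ Δ := by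
  by_contra! hall
  have h1 : ∏ p ∈ T, p ∣ Δ.natAbs := Finset.prod_primes_dvd _ (fun p hp => (hT p hp).1.prime)
    fun p hp => Int.natCast_dvd.1 (hall p hp)
  have h2 := Nat.le_of_dvd (Int.natAbs_pos.2 hΔ) h1
  have h3 : N ^ T.card < ∏ p ∈ T, p := by
    rw [← Finset.prod_const]
    obtain ⟨p, hp⟩ := hT0
    have hN : 0 < N := by
      by_contra h0
      have h0 : N = 0 := by omega
      have : Δ = 0 := by
        simpa [h0, Finset.card_ne_zero_of_mem hp] using hle
      exact hΔ this
    exact Finset.prod_lt_prod (fun _ _ => hN) (fun q hq => (hT q hq).2.le) ⟨p, hp, (hT p hp).2⟩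
  have h4 : (Δ.natAbs : ℤ) ≤ (N : ℤ) ^ T.card := by rwa [Int.natCast_natAbs]
  have h5 : Δ.natAbs ≤ N ^ T.card := by exact_mod_cast h4
  omega

end Congruences

section RealCurves

open Module Polynomial

variable {A : Type*} [CommRing A] [Algebra ℝ A] {n : ℕ}

/-- The algebra generated by `x` is the coordinate ring of a real affine curve of degree `d`. -/
structure IsRealCurve (x : Fin n → A) (d : ℕ) : Prop where
  pos : 0 < d
  gen : ∀ a : A, ∃ t, a ∈ linSpan x ^ t
  hilbert : ∃ s₀, ∀ s ≥ s₀, finrank ℝ (linSpan x ^ (s + 1) : Submodule ℝ A) =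
    finrank ℝ (linSpan x ^ s : Submodule ℝ A) + d
  faithful : ∀ a : A, (∀ φ : A →ₐ[ℝ] ℝ, φ a = 0) → a = 0

/-- The integer point `z` is a real point of the affine scheme with coordinates `x`. -/
def IsIntPoint (x : Fin n → A) (z : Fin n → ℤ) : Prop :=
  ∃ φ : A →ₐ[ℝ] ℝ, ∀ i, φ (x i) = z i

namespace IsRealCurve

variable {x : Fin n → A} {d : ℕ}

theorem infinite_algHom (hx : IsRealCurve x d) : Infinite (A →ₐ[ℝ] ℝ) := by
  obtain ⟨s₀, hs₀⟩ := hx.hilbert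
  exact infinite_points hx.pos hs₀ hx.faithful

theorem finrank_le [IsDomain A] (hx : IsRealCurve x d) (s : ℕ) :
    finrank ℝ (linSpan x ^ s : Submodule ℝ A) ≤ d * s + 1 := by
  obtain ⟨s₀, hs₀⟩ := hx.hilbert
  have := hx.infinite_algHom
  exact finrank_pow_le (one_le_linSpan x) hx.gen hs₀ s

theorem le_finrank [IsDomain A] (hx : IsRealCurve x d) (s : ℕ) :
    d * s ≤ finrank ℝ (linSpan x ^ s : Submodule ℝ A) + d * d := by
  obtain ⟨s₀, hs₀⟩ := hx.hilbert
  exact mul_le_finrank_pow_add_sq (one_le_linSpan x) hx.pos hx.finrank_le hs₀ s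

theorem card_points_le [IsDomain A] (hx : IsRealCurve x d) {s : ℕ} {f : A}
    (hf : f ∈ linSpan x ^ s) (hf0 : f ≠ 0) (Z : Finset (Fin n → ℤ))
    (hZ : ∀ z ∈ Z, ∃ φ : A →ₐ[ℝ] ℝ, (∀ i, φ (x i) = z i) ∧ φ f = 0) : Z.card ≤ d * s := by
  classical
  obtain ⟨s₀, hs₀⟩ := hx.hilbert
  have := hx.infinite_algHom
  choose! φ hφ hφf using hZ
  have hinj : Set.InjOn φ (Z : Set (Fin n → ℤ)) := by
    intro z hz w hw h
    funext i
    have h1 := hφ z hz i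
    rw [h, hφ w hw i] at h1
    exact_mod_cast h1.symm
  rw [← Finset.card_image_of_injOn hinj]
  refine card_zeros_le (one_le_linSpan x) hx.gen hs₀ hf hf0 _ fun ψ hψ => ?_
  obtain ⟨z, hz, rfl⟩ := Finset.mem_image.1 hψ
  exact hφf z hz

theorem exists_transcendental [IsDomain A] (hx : IsRealCurve x d) :
    ∃ i, ∀ q : ℝ[X], q ≠ 0 → aeval (x i) q ≠ 0 := by
  by_contra! h
  have hspan : linSpan x = 1 := by
    refine le_antisymm (Submodule.span_le.2 ?_) (one_le_linSpan x)
    rintro _ (rfl | ⟨i, rfl⟩)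
    · exact Submodule.one_le.1 le_rfl
    · obtain ⟨q, hq, hqx⟩ := h i
      obtain ⟨r, hr⟩ := exists_eq_algebraMap_of_aeval_eq_zero hx.faithful hq hqx
      rw [hr]
      exact Submodule.algebraMap_mem r
  obtain ⟨s₀, hs₀⟩ := hx.hilbert
  have := hs₀ s₀ le_rfl
  rw [hspan, one_pow, one_pow] at this
  have := hx.pos
  omega

theorem map_planeEval_intCast {M N : ℕ} (c : Fin M × Fin N → ℤ) {φ : A →ₐ[ℝ] ℝ} {z : Fin n → ℤ}
    (hφ : ∀ i, φ (x i) = z i) (i j : Fin n) :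
    φ (planeEval (fun k => algebraMap ℝ A (c k)) (x i) (x j)) =
      ((planeEval c (z i) (z j) : ℤ) : ℝ) := by
  have h1 := map_planeEval (φ : A →+* ℝ) (fun k => algebraMap ℝ A (c k)) (x i) (x j)
  have h2 := map_planeEval (Int.castRingHom ℝ) c (z i) (z j)
  simp only [RingHom.coe_coe, hφ, AlgHom.commutes, eq_intCast] at h1 h2
  rw [h1, h2]
  rfl

theorem map_planeDeriv_intCast {M N : ℕ} (c : Fin M × Fin N → ℤ) {φ : A →ₐ[ℝ] ℝ} {z : Fin n → ℤ}
    (hφ : ∀ i, φ (x i) = z i) (i j : Fin n) :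
    φ (planeDeriv (fun k => algebraMap ℝ A (c k)) (x i) (x j)) =
      ((planeDeriv c (z i) (z j) : ℤ) : ℝ) := by
  have h1 := map_planeDeriv (φ : A →+* ℝ) (fun k => algebraMap ℝ A (c k)) (x i) (x j)
  have h2 := map_planeDeriv (Int.castRingHom ℝ) c (z i) (z j)
  simp only [RingHom.coe_coe, hφ, AlgHom.commutes, eq_intCast] at h1 h2
  rw [h1, h2]
  rfl

theorem abs_planeDeriv_le {M N : ℕ} (c : Fin M × Fin N → ℤ) {y z : ℤ} {B K : ℝ} (hB : 1 ≤ B)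
    (hK : 0 ≤ K) (hc : ∀ k, |(c k : ℝ)| ≤ K) (hy : |(y : ℝ)| ≤ B) (hz : |(z : ℝ)| ≤ B) :
    |((planeDeriv c y z : ℤ) : ℝ)| ≤ (M * N : ℕ) * (K * (N * B ^ (M + N))) := by
  rw [planeDeriv]
  push_cast
  refine (Finset.abs_sum_le_sum_abs _ _).trans ?_
  have hterm : ∀ k : Fin M × Fin N,
      |(c k : ℝ) * ((y : ℝ) ^ (k.1 : ℕ) * ((k.2 : ℕ) * (z : ℝ) ^ ((k.2 : ℕ) - 1)))| ≤
        K * (N * B ^ (M + N)) := by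
    intro k
    rw [abs_mul]
    refine mul_le_mul (hc k) ?_ (abs_nonneg _) hK
    rw [abs_mul, abs_mul, abs_pow, abs_pow, Nat.abs_cast]
    have h1 : |(y : ℝ)| ^ (k.1 : ℕ) ≤ B ^ M :=
      (pow_le_pow_left₀ (abs_nonneg _) hy _).trans (pow_le_pow_right₀ hB k.1.2.le)
    have h2 : |(z : ℝ)| ^ ((k.2 : ℕ) - 1) ≤ B ^ N :=
      (pow_le_pow_left₀ (abs_nonneg _) hz _).trans
        (pow_le_pow_right₀ hB ((Nat.sub_le _ _).trans k.2.2.le))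
    have h3 : ((k.2 : ℕ) : ℝ) ≤ N := by exact_mod_cast k.2.2.le
    calc |(y : ℝ)| ^ (k.1 : ℕ) * (((k.2 : ℕ) : ℝ) * |(z : ℝ)| ^ ((k.2 : ℕ) - 1))
        ≤ B ^ M * (N * B ^ N) := by gcongr
      _ = N * B ^ (M + N) := by ring
  refine (Finset.sum_le_sum fun k _ => hterm k).trans ?_
  simp

/-- Any coordinate of the integer points of height at most `B` satisfies, together with a fixed
coordinate, a small integer relation that is separable outside few points. -/
theorem exists_int_plane_relation [IsDomain A] (hx : IsRealCurve x d) {i₀ : Fin n}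
    (hi₀ : ∀ q : ℝ[X], q ≠ 0 → aeval (x i₀) q ≠ 0) {B : ℝ} (hB : 1 ≤ B)
    {Z : Finset (Fin n → ℤ)} (hZ : ∀ z ∈ Z, IsIntPoint x z)
    (hZB : ∀ z ∈ Z, ∀ i, |(z i : ℝ)| ≤ B) (i : Fin n) :
    ∃ r ≤ 2 * d, ∃ c : Fin (2 * d + 1) × Fin (r + 1) → ℤ,
      (∀ z ∈ Z, planeEval c (z i₀) (z i) = 0) ∧
      (∀ z ∈ Z, |((planeDeriv c (z i₀) (z i) : ℤ) : ℝ)| ≤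
        ((2 * d + 1) ^ 2 * B ^ (4 * d + 2)) ^ ((2 * d + 1) ^ 2 + 2)) ∧
      (Z.filter fun z => planeDeriv c (z i₀) (z i) = 0).card ≤ d * (4 * d) := by
  classical
  rcases le_or_gt Z.card (d * (4 * d)) with hcard | hcard
  · refine ⟨0, Nat.zero_le _, 0, ?_, ?_, (Finset.card_filter_le _ _).trans hcard⟩
    · simp [planeEval]
    · intro z _
      simp only [planeDeriv, Pi.zero_apply, zero_mul, Finset.sum_const_zero, Int.cast_zero,
        abs_zero]
      positivity
  obtain ⟨c₀, hc₀, hrel₀⟩ := exists_plane_relation (one_le_linSpan x) hx.pos hx.finrank_le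
    (mem_linSpan x i₀) (mem_linSpan x i)
  obtain ⟨r, hr, ⟨c₁, hc₁, hrel₁⟩, hsep⟩ := exists_separable_plane_relation
    ⟨c₀, hc₀, by simpa [planeEval, Algebra.smul_def] using hrel₀⟩ hi₀
  have hr' : (r : ℝ) ≤ 2 * d := by exact_mod_cast hr
  have := hx.infinite_algHom
  choose! φ hφ using hZ
  have hR : ∀ z ∈ Z, ∀ k : Fin (2 * d + 1) × Fin (r + 1),
      |((z i₀ ^ (k.1 : ℕ) * z i ^ (k.2 : ℕ) : ℤ) : ℝ)| ≤ B ^ (4 * d + 2) := by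
    intro z hz k
    push_cast
    rw [abs_mul, abs_pow, abs_pow]
    calc |(z i₀ : ℝ)| ^ (k.1 : ℕ) * |(z i : ℝ)| ^ (k.2 : ℕ)
        ≤ B ^ (k.1 : ℕ) * B ^ (k.2 : ℕ) := by gcongr <;> exact hZB z hz _
      _ = B ^ ((k.1 : ℕ) + (k.2 : ℕ)) := (pow_add _ _ _).symm
      _ ≤ B ^ (4 * d + 2) := pow_le_pow_right₀ hB (by omega)
  have hB1 : 1 ≤ B ^ (4 * d + 2) := one_le_pow₀ hB
  obtain ⟨c, hc, hrel, hsize⟩ := exists_int_solution Z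
    (fun z k => z i₀ ^ (k.1 : ℕ) * z i ^ (k.2 : ℕ)) hc₁ (by
      intro z hz
      have h1 := congrArg (φ z) hrel₁
      simp only [planeEval, map_sum, map_mul, map_pow, AlgHom.commutes, hφ z hz, map_zero] at h1
      simpa using h1) hB1 hR
  have hrel' : ∀ z ∈ Z, planeEval c (z i₀) (z i) = 0 := hrel
  refine ⟨r, hr, c, hrel', fun z hz => ?_, ?_⟩
  · have hcardι : (Fintype.card (Fin (2 * d + 1) × Fin (r + 1)) : ℝ) ≤ (2 * d + 1) ^ 2 := by
      simp only [Fintype.card_prod, Fintype.card_fin]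
      push_cast
      nlinarith
    have hcardι' : Fintype.card (Fin (2 * d + 1) × Fin (r + 1)) ≤ (2 * d + 1) ^ 2 := by
      exact_mod_cast hcardι
    set m : ℝ := (2 * d + 1) ^ 2 with hm
    have hm1 : 1 ≤ m := one_le_pow₀ (by linarith [Nat.cast_nonneg (α := ℝ) d])
    set Q := B ^ (4 * d + 2) with hQ
    have hmQ : 1 ≤ m * Q := one_le_mul_of_one_le_of_one_le hm1 hB1
    have hsize' : ∀ k, |(c k : ℝ)| ≤ (m * Q) ^ ((2 * d + 1) ^ 2) := fun k =>
      (hsize k).trans ((pow_le_pow_left₀ (by positivity) (by gcongr) _).trans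
        (pow_le_pow_right₀ hmQ hcardι'))
    refine (abs_planeDeriv_le c hB (by positivity) hsize' (hZB z hz i₀) (hZB z hz i)).trans ?_
    have h1 : (((2 * d + 1) * (r + 1) : ℕ) : ℝ) ≤ m := by
      simpa only [Fintype.card_prod, Fintype.card_fin] using hcardι
    have h2 : ((r + 1 : ℕ) : ℝ) ≤ m := by
      push_cast
      nlinarith
    have h3 : B ^ (2 * d + 1 + (r + 1)) ≤ Q := pow_le_pow_right₀ hB (by omega)
    calc (((2 * d + 1) * (r + 1) : ℕ) : ℝ) * ((m * Q) ^ ((2 * d + 1) ^ 2) *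
          (((r + 1 : ℕ) : ℝ) * B ^ (2 * d + 1 + (r + 1))))
        ≤ (m * Q) * ((m * Q) ^ ((2 * d + 1) ^ 2) * (m * Q)) := by
          gcongr
          exact h1.trans (le_mul_of_one_le_right (by positivity) hB1)
      _ = (m * Q) ^ ((2 * d + 1) ^ 2 + 2) := by ring
  · have hmem : ∀ (e : Fin (2 * d + 1) × Fin (r + 1) → ℝ) (u v : ℕ → ℕ),
        (∀ k : Fin (2 * d + 1) × Fin (r + 1), u k.1 + v k.2 ≤ 4 * d) →
        ∑ k, e k • (x i₀ ^ u k.1 * x i ^ v k.2) ∈ linSpan x ^ (4 * d) := fun e u v huv =>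
      Submodule.sum_mem _ fun k _ => Submodule.smul_mem _ _ (pow_mono_of_one_le
        (one_le_linSpan x) (huv k) (monomial_mem_pow (mem_linSpan x i₀) (mem_linSpan x i) _ _))
    have hzero : planeEval (fun k => algebraMap ℝ A (c k)) (x i₀) (x i) = 0 := by
      by_contra hne
      refine absurd (hx.card_points_le (s := 4 * d) ?_ hne Z fun z hz => ⟨φ z, hφ z hz, ?_⟩)
        (not_le.2 hcard)
      · have := hmem (fun k => c k) id id (fun k => by simp only [id]; omega)
        simpa only [planeEval, Algebra.smul_def, id] using this
      · rw [map_planeEval_intCast c (hφ z hz), hrel' z hz, Int.cast_zero]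
    have hne := hsep (fun k => c k) (fun h => hc (funext fun k => by
      simpa using congrFun h k)) hzero
    refine hx.card_points_le (s := 4 * d) ?_ hne _ fun z hz => ?_
    · have := hmem (fun k => c k * (k.2 : ℕ)) id (fun b => b - 1)
        (fun k => by simp only [id]; omega)
      simp only [planeDeriv]
      convert this using 2 with k
      simp only [Algebra.smul_def, id, map_mul, map_natCast]
      ring
    · obtain ⟨hz, hz0⟩ := Finset.mem_filter.1 hz
      exact ⟨φ z, hφ z hz, by rw [map_planeDeriv_intCast c (hφ z hz), hz0, Int.cast_zero]⟩

end IsRealCurve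

end RealCurves

section ResidueClasses

open Module Polynomial

theorem prod_pow_sub_mul_pow (p s : ℕ) :
    (∏ j : Fin s, p ^ (s - j)) * p ^ (s * (s - 1) / 2) = (p ^ s) ^ s := by
  have h : ∑ j : Fin s, (s - (j : ℕ)) + s * (s - 1) / 2 = s * s := by
    rw [← Finset.sum_range_id, ← Fin.sum_univ_eq_sum_range, ← Finset.sum_add_distrib,
      Finset.sum_congr rfl fun j _ => Nat.sub_add_cancel j.2.le]
    simp
  rw [Finset.prod_pow_eq_pow_sum, ← pow_add, h, pow_mul]

variable {A : Type*} [CommRing A] [Algebra ℝ A] {n : ℕ} {x : Fin n → A} {d : ℕ}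

namespace IsRealCurve

/-- A residue class on which all coordinates are polynomials in one of them contains few integer
points. -/
theorem card_class_le [IsDomain A] (hx : IsRealCurve x d) {D : ℕ} {E : Finset (Fin n → ℕ)}
    (hE0 : E.Nonempty) (hE : ∀ α ∈ E, ∑ i, α i ≤ D)
    (hli : LinearIndepOn ℝ (fun α : Fin n → ℕ => ∏ i, x i ^ α i) (E : Set (Fin n → ℕ)))
    {p : ℕ} (hp : 0 < p) {B : ℝ} (hB : 1 ≤ B)
    (hsize : (2 * E.card : ℝ) ^ E.card * B ^ (∑ α ∈ E, ∑ i, α i) ≤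
      (p : ℝ) ^ (E.card * (E.card - 1) / 2))
    (i₀ : Fin n) (a : ℤ) (g : Fin n → ℤ[X]) {Z : Finset (Fin n → ℤ)}
    (hZ : ∀ z ∈ Z, IsIntPoint x z) (hZB : ∀ z ∈ Z, ∀ i, |(z i : ℝ)| ≤ B)
    (ha : ∀ z ∈ Z, (p : ℤ) ∣ z i₀ - a)
    (hg : ∀ z ∈ Z, ∀ i, (p : ℤ) ^ E.card ∣ z i - (g i).eval (z i₀ - a)) :
    Z.card ≤ d * D := by
  classical
  set s := E.card with hs
  have hs0 : (0 : ℝ) < s := by exact_mod_cast hE0.card_pos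
  have hp0 : (0 : ℝ) < p := by exact_mod_cast hp
  have hB0 : 0 < B := by linarith
  let T : ℝ := (p : ℝ) ^ s / (2 * s)
  have hT0 : 0 < T := by positivity
  let m : E → ℕ := fun α => ⌊T / B ^ (∑ i, α.1 i)⌋₊
  obtain ⟨h, hh0, hhm, hhdvd⟩ := exists_small_combination
    (fun α : E => ∏ i, g i ^ α.1 i) m p s hp (by
      have h1 : T ^ s / B ^ (∑ α ∈ E, ∑ i, α i) < ∏ α, ((m α : ℝ) + 1) := by
        have : T ^ s / B ^ (∑ α ∈ E, ∑ i, α i) = ∏ α : E, T / B ^ (∑ i, α.1 i) := by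
          rw [Finset.prod_div_distrib, Finset.prod_pow_eq_pow_sum, Finset.prod_const,
            Finset.card_univ, Fintype.card_coe, Finset.sum_coe_sort E fun α => ∑ i, α i]
        rw [this]
        have hne : (Finset.univ : Finset E).Nonempty := by
          obtain ⟨α, hα⟩ := hE0
          exact ⟨⟨α, hα⟩, Finset.mem_univ _⟩
        exact Finset.prod_lt_prod_of_nonempty (fun α _ => by positivity)
          (fun α _ => Nat.lt_floor_add_one _) hne
      have h2 : ((∏ j : Fin s, p ^ (s - j) : ℕ) : ℝ) ≤
          T ^ s / B ^ (∑ α ∈ E, ∑ i, α i) := by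
        rw [le_div_iff₀ (by positivity)]
        have h3 : ((∏ j : Fin s, p ^ (s - j) : ℕ) : ℝ) * (p : ℝ) ^ (s * (s - 1) / 2) =
            (2 * s : ℝ) ^ s * T ^ s := by
          rw [← mul_pow, mul_div_cancel₀ _ (by positivity)]
          exact_mod_cast prod_pow_sub_mul_pow p s
        have h4 := mul_le_mul_of_nonneg_left hsize
          (Nat.cast_nonneg (α := ℝ) (∏ j : Fin s, p ^ (s - j)))
        rw [h3] at h4
        have h5 : (0 : ℝ) < (2 * s : ℝ) ^ s := by positivity
        refine le_of_mul_le_mul_left ?_ h5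
        linarith
      have h6 := h2.trans_lt h1
      exact_mod_cast h6)
  have hne : ∑ α : E, (h α : ℝ) • ∏ i, x i ^ α.1 i ≠ 0 := by
    intro h0
    apply hh0
    funext α
    have := Fintype.linearIndependent_iff.1 hli (fun α => (h α : ℝ)) h0 α
    simpa using this
  have hmem : ∑ α : E, (h α : ℝ) • ∏ i, x i ^ α.1 i ∈ linSpan x ^ D :=
    Submodule.sum_mem _ fun α _ => Submodule.smul_mem _ _
      (pow_mono_of_one_le (one_le_linSpan x) (hE α.1 α.2) (prod_pow_mem_linSpan_pow x α.1))
  refine hx.card_points_le hmem hne Z fun z hz => ?_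
  obtain ⟨φ, hφ⟩ := hZ z hz
  refine ⟨φ, hφ, ?_⟩
  have hdvd : (p : ℤ) ^ s ∣ ∑ α : E, h α * ∏ i, z i ^ α.1 i := by
    have h1 := hhdvd (z i₀ - a) (ha z hz)
    rw [← Int.modEq_zero_iff_dvd] at h1 ⊢
    refine Int.ModEq.trans ?_ h1
    refine Int.ModEq.sum fun α _ => Int.ModEq.mul_left _ ?_
    rw [eval_prod]
    refine Int.ModEq.prod fun i _ => ?_
    rw [eval_pow]
    exact ((Int.modEq_iff_dvd.2 (hg z hz i)).symm).pow _
  have habs : |∑ α : E, h α * ∏ i, z i ^ α.1 i| < (p : ℤ) ^ s := by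
    have hterm : ∀ α : E, |((h α * ∏ i, z i ^ α.1 i : ℤ) : ℝ)| ≤ T := by
      intro α
      push_cast
      rw [abs_mul, Finset.abs_prod]
      have h1 : |(h α : ℝ)| ≤ T / B ^ (∑ i, α.1 i) := by
        have : |(h α : ℝ)| ≤ m α := by exact_mod_cast hhm α
        exact this.trans (Nat.floor_le (by positivity))
      have h2 : ∏ i, |(z i : ℝ) ^ α.1 i| ≤ B ^ (∑ i, α.1 i) := by
        rw [← Finset.prod_pow_eq_pow_sum]
        refine Finset.prod_le_prod (fun i _ => abs_nonneg _) fun i _ => ?_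
        rw [abs_pow]
        exact pow_le_pow_left₀ (abs_nonneg _) (hZB z hz i) _
      calc _ ≤ T / B ^ (∑ i, α.1 i) * B ^ (∑ i, α.1 i) :=
            mul_le_mul h1 h2 (Finset.prod_nonneg fun i _ => abs_nonneg _) (by positivity)
        _ = T := div_mul_cancel₀ _ (by positivity)
    have hsum : |((∑ α : E, h α * ∏ i, z i ^ α.1 i : ℤ) : ℝ)| ≤ s * T := by
      rw [Int.cast_sum]
      refine (Finset.abs_sum_le_sum_abs _ _).trans ?_
      refine (Finset.sum_le_sum fun α _ => hterm α).trans ?_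
      simp [hs]
    have hsT : s * T < (p : ℝ) ^ s := by
      have : s * T = (p : ℝ) ^ s / 2 := by
        simp only [T]
        field_simp
      rw [this]
      exact half_lt_self (by positivity)
    have := hsum.trans_lt hsT
    exact_mod_cast this
  have hzero := Int.eq_zero_of_abs_lt_dvd hdvd habs
  have : φ (∑ α : E, (h α : ℝ) • ∏ i, x i ^ α.1 i) =
      ((∑ α : E, h α * ∏ i, z i ^ α.1 i : ℤ) : ℝ) := by
    simp [map_sum, map_prod, hφ]
  rw [this, hzero, Int.cast_zero]

/-- The number of integer points of bounded height reducing to smooth points modulo a prime. -/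
theorem card_smooth_le [IsDomain A] (hx : IsRealCurve x d) {D : ℕ} {E : Finset (Fin n → ℕ)}
    (hE0 : E.Nonempty) (hE : ∀ α ∈ E, ∑ i, α i ≤ D)
    (hli : LinearIndepOn ℝ (fun α : Fin n → ℕ => ∏ i, x i ^ α i) (E : Set (Fin n → ℕ)))
    {p : ℕ} (hp : p.Prime) {B : ℝ} (hB : 1 ≤ B)
    (hsize : (2 * E.card : ℝ) ^ E.card * B ^ (∑ α ∈ E, ∑ i, α i) ≤
      (p : ℝ) ^ (E.card * (E.card - 1) / 2))
    (i₀ : Fin n) {M R : ℕ} {r : Fin n → ℕ} (hr : ∀ i, r i ≤ R)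
    (c : ∀ i, Fin M × Fin (r i + 1) → ℤ) {Z : Finset (Fin n → ℤ)}
    (hZ : ∀ z ∈ Z, IsIntPoint x z) (hZB : ∀ z ∈ Z, ∀ i, |(z i : ℝ)| ≤ B)
    (hc : ∀ z ∈ Z, ∀ i, planeEval (c i) (z i₀) (z i) = 0)
    (hsm : ∀ z ∈ Z, ∀ i, ¬ (p : ℤ) ∣ planeDeriv (c i) (z i₀) (z i)) :
    Z.card ≤ d * D * (p * R ^ n) := by
  classical
  have : Fact p.Prime := ⟨hp⟩
  let red : (Fin n → ℤ) → (Fin n → ZMod p) := fun z i => (z i : ZMod p)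
  have hfib : ∀ b ∈ Z.image red, (Z.filter fun z => red z = b).card ≤ d * D := by
    intro b hb
    obtain ⟨a, haZ, rfl⟩ := Finset.mem_image.1 hb
    have hcong : ∀ z ∈ Z.filter fun z => red z = red a, ∀ i, (p : ℤ) ∣ z i - a i := by
      intro z hz i
      have := congrFun (Finset.mem_filter.1 hz).2 i
      rw [← ZMod.intCast_zmod_eq_zero_iff_dvd, Int.cast_sub, sub_eq_zero]
      exact this
    have hinv : ∀ i, ∃ w, (p : ℤ) ∣ w * planeDeriv (c i) (a i₀) (a i) - 1 := by
      intro i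
      obtain ⟨u, v, huv⟩ := (((Nat.prime_iff_prime_int.1 hp).coprime_iff_not_dvd).2 (hsm a haZ i))
      exact ⟨v, -u, by linarith⟩
    choose w hw using hinv
    choose g hg using fun i => exists_hensel_polynomial (c i) p (a i₀) (a i) (w i) (hw i)
      (E.card - 1)
    refine hx.card_class_le hE0 hE hli hp.pos hB hsize i₀ (a i₀) g
      (fun z hz => hZ z (Finset.mem_filter.1 hz).1) (fun z hz => hZB z (Finset.mem_filter.1 hz).1)
      (fun z hz => hcong z hz i₀) fun z hz i => ?_
    have := hg i (z i₀) (z i) (hcong z hz i₀) (hcong z hz i) (hc z (Finset.mem_filter.1 hz).1 i)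
    rwa [Nat.sub_add_cancel hE0.card_pos] at this
  refine (Finset.card_le_mul_card_image Z _ hfib).trans (Nat.mul_le_mul_left _ ?_)
  let c' : ∀ i, Fin M × Fin (r i + 1) → ZMod p := fun i k => (c i k : ZMod p)
  let fib : ZMod p → Fin n → Finset (ZMod p) := fun u i =>
    Finset.univ.filter fun v => planeEval (c' i) u v = 0 ∧ planeDeriv (c' i) u v ≠ 0
  have hsub : Z.image red ⊆ Finset.univ.biUnion fun u => Fintype.piFinset (fib u) := by
    intro b hb
    obtain ⟨z, hz, rfl⟩ := Finset.mem_image.1 hb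
    rw [Finset.mem_biUnion]
    refine ⟨red z i₀, Finset.mem_univ _, Fintype.mem_piFinset.2 fun i => ?_⟩
    rw [Finset.mem_filter]
    have h1 := map_planeEval (Int.castRingHom (ZMod p)) (c i) (z i₀) (z i)
    have h2 := map_planeDeriv (Int.castRingHom (ZMod p)) (c i) (z i₀) (z i)
    refine ⟨Finset.mem_univ _, ?_, fun h0 => hsm z hz i ?_⟩
    · exact h1.symm.trans (by rw [hc z hz i, map_zero])
    · rw [← ZMod.intCast_zmod_eq_zero_iff_dvd]
      exact h2.trans h0
  refine (Finset.card_le_card hsub).trans (Finset.card_biUnion_le.trans ?_)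
  refine (Finset.sum_le_card_nsmul _ _ (R ^ n) fun u _ => ?_).trans (by simp [ZMod.card])
  rw [Fintype.card_piFinset]
  refine (Finset.prod_le_pow_card _ _ R fun i _ => ?_).trans (by simp)
  exact (card_smooth_fiber_le (c' i) u).trans (hr i)

end IsRealCurve

end ResidueClasses

section Counting

open Module Polynomial

/-- The numerical input of the determinant method: in large degree the average monomial degree is
small compared to the number of monomials. -/
theorem exists_degree_weight_le {d : ℕ} (hd : 0 < d) {ε : ℝ} (hε : 0 < ε) :
    ∃ D : ℕ, ∀ (H : ℕ → ℕ) (w : ℕ), (∀ s, H s ≤ d * s + 1) → (∀ s, d * s ≤ H s + d * d) →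
      w + ∑ j ∈ Finset.range D, H j ≤ D * H D →
      3 ≤ H D ∧ (w : ℝ) ≤ (1 / d + ε) * ((H D * (H D - 1) / 2 : ℕ) : ℝ) := by
  have hd1 : (1 : ℝ) ≤ d := by exact_mod_cast hd
  have hd0 : (0 : ℝ) < d := by linarith
  obtain ⟨D₀, hD₀⟩ := exists_nat_ge
    (2 * ((1 + ε * d) * (d ^ 2 + 1) + 1 + d / 2 + d ^ 2) / (ε * d ^ 2))
  refine ⟨D₀ + d + 3, fun H w hle hge hw => ?_⟩
  set D := D₀ + d + 3 with hD
  have hD' : 2 * ((1 + ε * d) * (d ^ 2 + 1) + 1 + d / 2 + d ^ 2) ≤ (D : ℝ) * (ε * d ^ 2) := by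
    rw [div_le_iff₀ (by positivity)] at hD₀
    refine hD₀.trans (mul_le_mul_of_nonneg_right ?_ (by positivity))
    exact_mod_cast (by omega : D₀ ≤ D)
  have h3 : 3 ≤ H D := by
    have h1 := hge D
    have h2 : d * d + 3 ≤ d * D := by nlinarith
    omega
  refine ⟨h3, ?_⟩
  have hq : ((H D * (H D - 1) / 2 : ℕ) : ℝ) * 2 = H D * (H D - 1) := by
    have h1 : H D * (H D - 1) / 2 * 2 = H D * (H D - 1) :=
      Nat.div_mul_cancel (Nat.even_mul_pred_self _).two_dvd
    have h2 : ((H D * (H D - 1) / 2 * 2 : ℕ) : ℝ) = ((H D * (H D - 1) : ℕ) : ℝ) := by rw [h1]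
    rw [Nat.cast_mul, Nat.cast_mul, Nat.cast_sub (by omega)] at h2
    simpa using h2
  have hsum : (d : ℝ) * (D * (D - 1)) ≤
      2 * (∑ j ∈ Finset.range D, (H j : ℝ)) + 2 * (D * d ^ 2) := by
    have h1 : ∑ j ∈ Finset.range D, (d * j : ℝ) ≤ ∑ j ∈ Finset.range D, ((H j : ℝ) + d * d) :=
      Finset.sum_le_sum fun j _ => by exact_mod_cast hge j
    rw [← Finset.mul_sum, Finset.sum_add_distrib, Finset.sum_const, Finset.card_range,
      nsmul_eq_mul] at h1
    have h2 : (∑ j ∈ Finset.range D, (j : ℝ)) * 2 = D * (D - 1) := by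
      have := Finset.sum_range_id_mul_two D
      have h4 : (((∑ j ∈ Finset.range D, j) * 2 : ℕ) : ℝ) = ((D * (D - 1) : ℕ) : ℝ) := by rw [this]
      rw [Nat.cast_mul, Nat.cast_mul, Nat.cast_sub (by omega)] at h4
      simpa using h4
    nlinarith
  have hwR : (w : ℝ) + ∑ j ∈ Finset.range D, (H j : ℝ) ≤ D * H D := by exact_mod_cast hw
  have hleR : (H D : ℝ) ≤ d * D + 1 := by exact_mod_cast hle D
  have hgeR : (d : ℝ) * D ≤ H D + d * d := by exact_mod_cast hge D
  have hDd : (d : ℝ) + 3 ≤ D := by exact_mod_cast (by omega : d + 3 ≤ D)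
  have hDpos : (0 : ℝ) < D := by linarith
  have hw2 : (w : ℝ) * 2 ≤ d * D ^ 2 + D * (2 + d + 2 * d ^ 2) := by
    have := mul_le_mul_of_nonneg_left hleR hDpos.le
    nlinarith
  have hs2 : (d : ℝ) ^ 2 * D ^ 2 - 2 * (d ^ 2 + 1) * (d * D) ≤ H D * (H D - 1) := by
    have h1 : 0 ≤ (d : ℝ) * D - d * d - 1 := by nlinarith
    have h2 : ((d : ℝ) * D - d * d - 1) * (d * D - d * d - 1) ≤ H D * (H D - 1) :=
      mul_le_mul (by linarith) (by linarith) h1 (Nat.cast_nonneg _)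
    nlinarith [sq_nonneg ((d : ℝ) ^ 2 + 1)]
  have hcoef : 0 ≤ 1 / (d : ℝ) + ε := by positivity
  have hmain := mul_le_mul_of_nonneg_left hs2 hcoef
  have hexpand : (1 / (d : ℝ) + ε) * ((d : ℝ) ^ 2 * D ^ 2 - 2 * (d ^ 2 + 1) * (d * D)) =
      d * D ^ 2 + D * (D * (ε * d ^ 2)) - D * (2 * ((1 + ε * d) * (d ^ 2 + 1))) := by
    field_simp
  rw [hexpand] at hmain
  have hfin := mul_le_mul_of_nonneg_left hD' hDpos.le
  have h5 : (1 / (d : ℝ) + ε) * ((H D * (H D - 1) / 2 : ℕ) : ℝ) * 2 =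
      (1 / (d : ℝ) + ε) * (H D * (H D - 1)) := by rw [mul_assoc, hq]
  linarith

theorem IsRealCurve.exists_card_le (n d : ℕ) {ε : ℝ} (hε : 0 < ε) :
    ∃ C : ℝ, ∀ {A : Type} [CommRing A] [Algebra ℝ A] [IsDomain A] {x : Fin n → A},
      IsRealCurve x d → ∀ {B : ℝ}, 1 ≤ B → ∀ Z : Finset (Fin n → ℤ), (∀ z ∈ Z, IsIntPoint x z) →
      (∀ z ∈ Z, ∀ i, |(z i : ℝ)| ≤ B) → (Z.card : ℝ) ≤ C * B ^ ((1 : ℝ) / d + ε) := by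
  classical
  rcases Nat.eq_zero_or_pos d with rfl | hd
  · exact ⟨0, fun hx => absurd hx.pos (lt_irrefl _)⟩
  obtain ⟨D, hD⟩ := exists_degree_weight_le hd hε
  let l : ℕ := (2 * d + 1) ^ 2 + 2
  let K : ℝ := ((2 * d + 1) ^ 2) ^ l
  let κ : ℕ := (4 * d + 2) * l
  let k : ℕ := n + d * κ * n + 1
  let C₀ : ℝ := 2 * (d * D + 1) + K
  have hK0 : 0 ≤ K := by positivity
  have hC₀ : 1 ≤ C₀ := by
    have : (0 : ℝ) ≤ d * D := by positivity
    simp only [C₀]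
    linarith
  refine ⟨n * (d * (4 * d)) + k * (d * D * (2 ^ k * (2 * C₀) * (2 * d) ^ n)), ?_⟩
  intro A _ _ _ x hx B hB Z hZ hZB
  have hB0 : 0 < B := by linarith
  set e : ℝ := (1 : ℝ) / d + ε with he
  have he0 : 0 ≤ e := by positivity
  have hBe : 1 ≤ B ^ e := Real.one_le_rpow hB he0
  obtain ⟨i₀, hi₀⟩ := hx.exists_transcendental
  choose r hr c hc hcK hexc using fun i => hx.exists_int_plane_relation hi₀ hB hZ hZB i
  obtain ⟨E, hE, hli, hEcard, hEw⟩ := exists_adapted_monomials x D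
  obtain ⟨hs3, hw⟩ := hD _ _ hx.finrank_le hx.le_finrank hEw
  rw [← hEcard] at hs3 hw
  have hsle : (E.card : ℝ) ≤ d * D + 1 := by
    rw [hEcard]
    exact_mod_cast hx.finrank_le D
  have hE0 : E.Nonempty := Finset.card_pos.1 (by omega)
  set P : ℝ := C₀ * B ^ e with hP
  have hP1 : 1 ≤ P := one_le_mul_of_one_le_of_one_le hC₀ hBe
  set N : ℕ := ⌈P⌉₊ with hN
  have hPN : P ≤ N := Nat.le_ceil P
  have hN2 : (N : ℝ) ≤ 2 * P := by
    have := Nat.ceil_lt_add_one (by linarith : 0 ≤ P)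
    linarith
  have hN1 : (1 : ℝ) ≤ N := hP1.trans hPN
  obtain ⟨T, hTcard, hT⟩ := exists_primes_in_range N (by
    intro h0
    rw [h0] at hN1
    norm_num at hN1) k
  have hsize : ∀ p ∈ T, (2 * E.card : ℝ) ^ E.card * B ^ (∑ α ∈ E, ∑ i, α i) ≤
      (p : ℝ) ^ (E.card * (E.card - 1) / 2) := by
    intro p hp
    have hPp : P ≤ p := hPN.trans (by exact_mod_cast (hT p hp).2.1.le)
    have hq : E.card ≤ E.card * (E.card - 1) / 2 := by
      rw [Nat.le_div_iff_mul_le (by norm_num)]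
      exact Nat.mul_le_mul_left _ (by omega)
    have h2s : (1 : ℝ) ≤ 2 * E.card := by
      have : (3 : ℝ) ≤ E.card := by exact_mod_cast hs3
      linarith
    refine le_trans ?_ (pow_le_pow_left₀ (by linarith) hPp _)
    rw [hP, mul_pow C₀]
    refine mul_le_mul ((pow_le_pow_right₀ h2s hq).trans
      (pow_le_pow_left₀ (by positivity) ?_ _)) ?_ (by positivity) (by positivity)
    · simp only [C₀]
      linarith
    · rw [← Real.rpow_natCast, ← Real.rpow_natCast, ← Real.rpow_mul hB0.le]
      exact Real.rpow_le_rpow_of_exponent_le hB hw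
  let exc : Fin n → Finset (Fin n → ℤ) := fun i =>
    Z.filter fun z => planeDeriv (c i) (z i₀) (z i) = 0
  let smooth : ℕ → Finset (Fin n → ℤ) := fun p =>
    Z.filter fun z => ∀ i, ¬ (p : ℤ) ∣ planeDeriv (c i) (z i₀) (z i)
  have hcover : Z ⊆ Finset.univ.biUnion exc ∪ T.biUnion smooth := by
    intro z hz
    rw [Finset.mem_union, Finset.mem_biUnion, Finset.mem_biUnion]
    by_cases hex : ∃ i, planeDeriv (c i) (z i₀) (z i) = 0
    · obtain ⟨i, hi⟩ := hex
      exact Or.inl ⟨i, Finset.mem_univ _, Finset.mem_filter.2 ⟨hz, hi⟩⟩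
    · right
      push Not at hex
      have hprod : ∏ i, planeDeriv (c i) (z i₀) (z i) ≠ 0 :=
        Finset.prod_ne_zero_iff.2 fun i _ => hex i
      have hsmall : |∏ i, planeDeriv (c i) (z i₀) (z i)| ≤ (N : ℤ) ^ T.card := by
        have h1 : |((∏ i, planeDeriv (c i) (z i₀) (z i) : ℤ) : ℝ)| ≤ (K * B ^ κ) ^ n := by
          rw [Int.cast_prod, Finset.abs_prod]
          refine (Finset.prod_le_prod (fun _ _ => abs_nonneg _) fun i _ => hcK i z hz).trans ?_
          rw [Finset.prod_const, Finset.card_univ, Fintype.card_fin, mul_pow (_ ^ 2), ← pow_mul B]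
        have h2 : K ≤ N := by
          refine le_trans ?_ hPN
          refine le_trans ?_ (le_mul_of_one_le_right (by linarith) hBe)
          have : (0 : ℝ) ≤ d * D := by positivity
          simp only [C₀]
          linarith
        have h3 : B ≤ (N : ℝ) ^ d := by
          have h4 : B ^ ((1 : ℝ) / d) ≤ N := by
            refine le_trans ?_ hPN
            refine le_trans ?_ (le_mul_of_one_le_left (by linarith) hC₀)
            exact Real.rpow_le_rpow_of_exponent_le hB (by linarith)
          have h5 : (B ^ ((1 : ℝ) / d)) ^ d = B := by
            rw [one_div]
            exact Real.rpow_inv_natCast_pow hB0.le hd.ne'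
          calc B = (B ^ ((1 : ℝ) / d)) ^ d := h5.symm
            _ ≤ (N : ℝ) ^ d := pow_le_pow_left₀ (by positivity) h4 _
        have h6 : (K * B ^ κ) ^ n ≤ (N : ℝ) ^ k := by
          calc (K * B ^ κ) ^ n ≤ (N * ((N : ℝ) ^ d) ^ κ) ^ n := by gcongr
            _ = (N : ℝ) ^ (n + d * κ * n) := by
              rw [mul_pow, ← pow_mul, ← pow_mul, ← pow_add, mul_assoc d]
            _ ≤ (N : ℝ) ^ k := pow_le_pow_right₀ hN1 (Nat.le_succ _)
        have h7 := h1.trans h6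
        rw [hTcard]
        exact_mod_cast h7
      obtain ⟨p, hpT, hp⟩ := exists_prime_not_dvd (N := N)
        (fun p hp => ⟨(hT p hp).1, (hT p hp).2.1⟩)
        (Finset.card_pos.1 (by rw [hTcard]; exact Nat.succ_pos _)) hprod hsmall
      exact ⟨p, hpT, Finset.mem_filter.2 ⟨hz, fun i hi =>
        hp (hi.trans (Finset.dvd_prod_of_mem _ (Finset.mem_univ i)))⟩⟩
  have hsmooth : ∀ p ∈ T, (smooth p).card ≤ d * D * (2 ^ k * N * (2 * d) ^ n) := by
    intro p hp
    refine (hx.card_smooth_le hE0 hE hli (hT p hp).1 hB (hsize p hp) i₀ hr c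
      (fun z hz => hZ z (Finset.mem_filter.1 hz).1) (fun z hz => hZB z (Finset.mem_filter.1 hz).1)
      (fun z hz i => hc i z (Finset.mem_filter.1 hz).1)
      (fun z hz => (Finset.mem_filter.1 hz).2)).trans
      ?_
    gcongr
    exact (hT p hp).2.2
  have hcount : Z.card ≤ n * (d * (4 * d)) + k * (d * D * (2 ^ k * N * (2 * d) ^ n)) := by
    refine (Finset.card_le_card hcover).trans ((Finset.card_union_le _ _).trans (add_le_add ?_ ?_))
    · refine Finset.card_biUnion_le.trans
        ((Finset.sum_le_card_nsmul _ _ _ fun i _ => hexc i).trans ?_)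
      simp
    · refine Finset.card_biUnion_le.trans ((Finset.sum_le_card_nsmul _ _ _ hsmooth).trans ?_)
      rw [hTcard, smul_eq_mul]
  have hcountR : (Z.card : ℝ) ≤ n * (d * (4 * d)) + k * (d * D * (2 ^ k * N * (2 * d) ^ n)) := by
    exact_mod_cast hcount
  calc (Z.card : ℝ) ≤ n * (d * (4 * d)) + k * (d * D * (2 ^ k * N * (2 * d) ^ n)) := hcountR
    _ ≤ n * (d * (4 * d)) * B ^ e + k * (d * D * (2 ^ k * (2 * P) * (2 * d) ^ n)) := by
      refine add_le_add (le_mul_of_one_le_right (by positivity) hBe) ?_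
      gcongr
    _ = (n * (d * (4 * d)) + k * (d * D * (2 ^ k * (2 * C₀) * (2 * d) ^ n))) * B ^ e := by
      rw [hP]
      ring

end Counting

section AffineCurves

open Module

variable {n : ℕ} (I : Ideal (MvPolynomial (Fin n) ℝ))

/-- The coordinate functions in the quotient by `I`. -/
noncomputable def coordFn (i : Fin n) : MvPolynomial (Fin n) ℝ ⧸ I :=
  Ideal.Quotient.mk I (MvPolynomial.X i)

theorem map_restrictTotalDegree_eq (s : ℕ) :
    (MvPolynomial.restrictTotalDegree (Fin n) ℝ s).map (Ideal.Quotient.mkₐ ℝ I).toLinearMap =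
      linSpan (coordFn I) ^ s := by
  rw [linSpan_pow_eq, MvPolynomial.restrictTotalDegree, MvPolynomial.restrictSupport_eq_span,
    Submodule.map_span, Set.image_image]
  congr 1
  ext f
  constructor
  · rintro ⟨m, hm, rfl⟩
    refine ⟨m, ?_, ?_⟩
    · simpa [Finsupp.sum_fintype] using hm
    · simp [MvPolynomial.monomial_eq, Finsupp.prod_fintype, coordFn, map_prod]
  · rintro ⟨α, hα, rfl⟩
    refine ⟨Finsupp.equivFunOnFinite.symm α, ?_, ?_⟩
    · simpa [Finsupp.sum_fintype] using hα
    · simp [MvPolynomial.monomial_eq, Finsupp.prod_fintype, coordFn, map_prod]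

theorem affineHilbertFn_eq (s : ℕ) :
    affineHilbertFn ℝ I s =
      finrank ℝ (linSpan (coordFn I) ^ s : Submodule ℝ (MvPolynomial (Fin n) ℝ ⧸ I)) := by
  rw [← map_restrictTotalDegree_eq]
  let f := (Ideal.Quotient.mkₐ ℝ I).toLinearMap.domRestrict
    (MvPolynomial.restrictTotalDegree (Fin n) ℝ s)
  have hker : LinearMap.ker f = Submodule.comap
      (MvPolynomial.restrictTotalDegree (Fin n) ℝ s).subtype (Submodule.restrictScalars ℝ I) := by
    ext g
    simp [f, LinearMap.domRestrict_apply, Ideal.Quotient.eq_zero_iff_mem]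
  have hrange : LinearMap.range f = (MvPolynomial.restrictTotalDegree (Fin n) ℝ s).map
      (Ideal.Quotient.mkₐ ℝ I).toLinearMap := LinearMap.range_domRestrict _ _
  rw [affineHilbertFn, ← hker, ← hrange]
  exact (LinearMap.quotKerEquivRange f).finrank_eq

theorem exists_algHom_of_mem_zeroSetOf {v : Fin n → ℝ} (hv : v ∈ zeroSetOf I) :
    ∃ φ : (MvPolynomial (Fin n) ℝ ⧸ I) →ₐ[ℝ] ℝ,
      ∀ f, φ (Ideal.Quotient.mk I f) = MvPolynomial.eval v f := by
  have hev : ∀ f, MvPolynomial.aeval v f = MvPolynomial.eval v f := fun f =>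
    RingHom.congr_fun (MvPolynomial.coe_aeval_eq_eval v) f
  have h0 : ∀ f ∈ I, MvPolynomial.aeval v f = 0 := fun f hf => (hev f).trans (hv f hf)
  refine ⟨Ideal.Quotient.liftₐ I (MvPolynomial.aeval v) h0, fun f => ?_⟩
  rw [Ideal.Quotient.liftₐ_apply]
  exact hev f

theorem isRealCurve_coordFn {d : ℕ} (P : Polynomial ℚ) (hI : I = vanishingIdeal (zeroSetOf I))
    (hP : P.natDegree = 1) (hPd : P.leadingCoeff = (d : ℚ))
    (hH : ∀ᶠ s : ℕ in Filter.atTop, (affineHilbertFn ℝ I s : ℚ) = P.eval (s : ℚ)) :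
    IsRealCurve (coordFn I) d where
  pos := by
    rw [Nat.pos_iff_ne_zero]
    rintro rfl
    rw [Nat.cast_zero, Polynomial.leadingCoeff_eq_zero] at hPd
    simp [hPd] at hP
  gen a := by
    obtain ⟨f, rfl⟩ := Ideal.Quotient.mk_surjective a
    refine ⟨f.totalDegree, ?_⟩
    rw [← map_restrictTotalDegree_eq]
    exact ⟨f, (MvPolynomial.mem_restrictTotalDegree _ _ _).2 le_rfl, rfl⟩
  hilbert := by
    obtain ⟨s₀, hs₀⟩ := Filter.eventually_atTop.1 hH
    refine ⟨s₀, fun s hs => ?_⟩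
    have h1 := hs₀ s hs
    have h2 := hs₀ (s + 1) (by omega)
    have hPeq : P = Polynomial.C (d : ℚ) * Polynomial.X + Polynomial.C (P.coeff 0) := by
      rw [← hPd, Polynomial.leadingCoeff, hP]
      exact Polynomial.eq_X_add_C_of_natDegree_le_one hP.le
    rw [affineHilbertFn_eq, hPeq] at h1 h2
    simp only [Polynomial.eval_add, Polynomial.eval_mul, Polynomial.eval_C,
      Polynomial.eval_X] at h1 h2
    have h3 : ((finrank ℝ (linSpan (coordFn I) ^ (s + 1) :
        Submodule ℝ (MvPolynomial (Fin n) ℝ ⧸ I)) : ℕ) : ℚ) =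
        (finrank ℝ (linSpan (coordFn I) ^ s :
          Submodule ℝ (MvPolynomial (Fin n) ℝ ⧸ I)) : ℕ) + d := by
      rw [h1, h2]
      push_cast
      ring
    exact_mod_cast h3
  faithful a ha := by
    obtain ⟨f, rfl⟩ := Ideal.Quotient.mk_surjective a
    rw [Ideal.Quotient.eq_zero_iff_mem, hI]
    intro v hv
    obtain ⟨φ, hφ⟩ := exists_algHom_of_mem_zeroSetOf I hv
    rw [← hφ, ha]

end AffineCurves

/-- For an irreducible closed curve `X ⊆ 𝔸^n_ℝ` of degree `d` (encoded by its vanishing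
ideal `I = I(X)`) and every `ε > 0` there is `C = C(n,d,ε)` with
`N(X,B) ≤ C·B^{1/d+ε}` for all `B ≥ 1`. -/
theorem affine_curve_point_count (n d : ℕ) (ε : ℝ) (hε : 0 < ε) :
    ∃ C : ℝ, ∀ (I : Ideal (MvPolynomial (Fin n) ℝ)) (P : Polynomial ℚ),
      I.IsPrime → I = vanishingIdeal (zeroSetOf I) →
      ringKrullDim (MvPolynomial (Fin n) ℝ ⧸ I) = (1 : WithBot (WithTop ℕ)) →
      P.natDegree = 1 → P.leadingCoeff = (d : ℚ) →
      (∀ᶠ s : ℕ in Filter.atTop, (affineHilbertFn ℝ I s : ℚ) = P.eval (s : ℚ)) →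
      ∀ B : ℝ, 1 ≤ B →
        (Set.ncard {x : Fin n → ℤ |
            ((fun i => (x i : ℝ)) ∈ zeroSetOf I) ∧ ∀ i, |(x i : ℝ)| ≤ B} : ℝ) ≤
          C * B ^ ((1 : ℝ) / (d : ℝ) + ε) := by
  obtain ⟨C, hC⟩ := IsRealCurve.exists_card_le n d hε
  refine ⟨C, fun I P hprime hI _ hP hPd hH B hB => ?_⟩
  have hfin : {x : Fin n → ℤ |
      ((fun i => (x i : ℝ)) ∈ zeroSetOf I) ∧ ∀ i, |(x i : ℝ)| ≤ B}.Finite := by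
    refine (Set.finite_Icc (fun _ : Fin n => -⌊B⌋) (fun _ => ⌊B⌋)).subset fun z hz => ?_
    refine ⟨fun i => ?_, fun i => ?_⟩
    · have := (abs_le.1 (hz.2 i)).1
      have h1 : -z i ≤ ⌊B⌋ := Int.le_floor.2 (by push_cast; linarith)
      dsimp only
      omega
    · exact Int.le_floor.2 (abs_le.1 (hz.2 i)).2
  rw [Set.ncard_eq_toFinset_card _ hfin]
  refine hC (isRealCurve_coordFn I P hI hP hPd hH) hB _ (fun z hz => ?_) fun z hz => ?_
  · obtain ⟨φ, hφ⟩ := exists_algHom_of_mem_zeroSetOf I (hfin.mem_toFinset.1 hz).1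
    exact ⟨φ, fun i => by rw [coordFn, hφ, MvPolynomial.eval_X]⟩
  · exact (hfin.mem_toFinset.1 hz).2
end

section
/- Let U ⊆ ℝ^m be compact and let φ = (φ_1,…,φ_n): U → [−1,1]^n be a C^ν map with ‖φ_j‖_ν ≤ 1 for each j. Let e = (e_0,e_1,…,e_n) ∈ ℤ_{≥0}^{n+1} with |e| = δ ≥ 1, and define ψ: U → ℝ by ψ(u) = φ_1(u)^{e_1}⋯φ_n(u)^{e_n} (i.e. ψ(u) = (1,φ(u))^e). Then ψ ∈ C^ν(U) and ‖ψ‖_ν ≤ δ^ν. -/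
/-- The iterated partial derivative `∂^α ψ` of a function `ψ : ℝ^m → ℝ`,
applying `∂_i` exactly `α i` times (in a fixed order). -/
noncomputable def pdAlpha {m : ℕ} (α : Fin m → ℕ) (ψ : (Fin m → ℝ) → ℝ) : (Fin m → ℝ) → ℝ :=
  (List.finRange m).foldr
    (fun i g => (fun h : (Fin m → ℝ) → ℝ => fun x => fderiv ℝ h x (Pi.single i 1))^[α i] g) ψ

/-- `‖ψ‖_k = max_{x ∈ U} max_{|α| ≤ k} |∂^α ψ(x)|` (as a supremum). -/
noncomputable def cknorm {m : ℕ} (k : ℕ) (U : Set (Fin m → ℝ)) (ψ : (Fin m → ℝ) → ℝ) : ℝ :=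
  sSup {y | ∃ α : Fin m → ℕ, (∑ i, α i) ≤ k ∧ ∃ x ∈ U, y = |pdAlpha α ψ x|}

/-- The partial derivative `∂_i h`. -/
noncomputable def partialD {m : ℕ} (i : Fin m) (h : (Fin m → ℝ) → ℝ) : (Fin m → ℝ) → ℝ :=
  fun x => fderiv ℝ h x (Pi.single i 1)

/-- Successive partial derivatives along a list of directions, the head being applied first. -/
noncomputable def partialDList {m : ℕ} (l : List (Fin m)) (h : (Fin m → ℝ) → ℝ) :
    (Fin m → ℝ) → ℝ :=
  l.foldl (fun g i => partialD i g) h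

/-- The list of directions, in decreasing order, in which `i` occurs `α i` times. -/
def directions {m : ℕ} (α : Fin m → ℕ) : List (Fin m) :=
  ((List.finRange m).flatMap fun i => List.replicate (α i) i).reverse

lemma pdAlpha_eq_partialDList {m : ℕ} (α : Fin m → ℕ) (ψ : (Fin m → ℝ) → ℝ) :
    pdAlpha α ψ = partialDList (directions α) ψ := by
  have iter : ∀ (k : ℕ) (i : Fin m) (g : (Fin m → ℝ) → ℝ),
      (List.replicate k i).foldr partialD g = (partialD i)^[k] g := by
    intro k i g
    induction k with
    | zero => rfl
    | succ k ih => rw [List.replicate_succ, List.foldr_cons, ih, Function.iterate_succ_apply']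
  unfold pdAlpha partialDList directions
  rw [List.foldl_reverse]
  induction List.finRange m with
  | nil => rfl
  | cons i l ih =>
    rw [List.foldr_cons, ih, List.flatMap_cons, List.foldr_append]
    exact (iter _ _ _).symm

lemma count_directions {m : ℕ} (α : Fin m → ℕ) (i : Fin m) :
    (directions α).count i = α i := by
  rw [directions, List.count_reverse, List.count_flatMap]
  have : (List.count i ∘ fun j => List.replicate (α j) j) = fun j => if j = i then α j else 0 := by
    funext j
    simp [List.count_replicate]
  rw [this, ← List.ofFn_eq_map, List.sum_ofFn]
  simp

lemma length_directions {m : ℕ} (α : Fin m → ℕ) : (directions α).length = ∑ i, α i := by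
  simp [directions, List.length_flatMap, ← List.ofFn_eq_map, List.sum_ofFn]

lemma pairwise_directions {m : ℕ} (α : Fin m → ℕ) : (directions α).Pairwise (· ≥ ·) := by
  rw [directions, List.pairwise_reverse, List.pairwise_flatMap]
  refine ⟨fun i _ => List.pairwise_replicate.2 (Or.inr le_rfl), ?_⟩
  refine (List.pairwise_lt_finRange m).imp fun {a b} hab x hx y hy => ?_
  rw [List.eq_of_mem_replicate hx, List.eq_of_mem_replicate hy]
  exact hab.le

lemma eq_directions_of_sublist {m : ℕ} {α : Fin m → ℕ} {l : List (Fin m)}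
    (h : l.Sublist (directions α)) : l = directions fun i => l.count i := by
  refine List.Perm.eq_of_pairwise (le := (· ≥ ·)) (fun a b _ _ hab hba => le_antisymm hba hab)
    ((pairwise_directions α).sublist h) (pairwise_directions _) ?_
  exact List.perm_iff_count.2 fun i => (count_directions (fun i => l.count i) i).symm

lemma contDiff_partialD {m k : ℕ} {f : (Fin m → ℝ) → ℝ} (i : Fin m)
    (hf : ContDiff ℝ (k + 1 : ℕ) f) : ContDiff ℝ k (partialD i f) := by
  have : ContDiff ℝ k (fderiv ℝ f) := hf.fderiv_right (by norm_cast)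
  exact this.clm_apply contDiff_const

lemma continuous_partialDList {m : ℕ} (l : List (Fin m)) {f : (Fin m → ℝ) → ℝ}
    (hf : ContDiff ℝ l.length f) : Continuous (partialDList l f) := by
  induction l generalizing f with
  | nil => exact hf.continuous
  | cons i l ih => exact ih (contDiff_partialD i hf)

lemma partialD_sum {m : ℕ} {ι : Type*} (s : Finset ι) (i : Fin m)
    {f : ι → (Fin m → ℝ) → ℝ} (hf : ∀ k ∈ s, Differentiable ℝ (f k)) :
    partialD i (fun x => ∑ k ∈ s, f k x) = fun x => ∑ k ∈ s, partialD i (f k) x := by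
  funext x
  simp only [partialD]
  rw [fderiv_fun_sum fun k hk => hf k hk x, sum_apply]

lemma partialDList_sum {m : ℕ} {ι : Type*} (s : Finset ι) (l : List (Fin m))
    {f : ι → (Fin m → ℝ) → ℝ} (hf : ∀ k ∈ s, ContDiff ℝ l.length (f k)) :
    partialDList l (fun x => ∑ k ∈ s, f k x) = fun x => ∑ k ∈ s, partialDList l (f k) x := by
  induction l generalizing f with
  | nil => rfl
  | cons i l ih =>
    change partialDList l (partialD i _) = _
    rw [partialD_sum s i fun k hk => (hf k hk).differentiable (by simp)]
    exact ih fun k hk => contDiff_partialD i (hf k hk)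

lemma partialD_prod {m : ℕ} {ι : Type*} [Fintype ι] [DecidableEq ι] (i : Fin m)
    {f : ι → (Fin m → ℝ) → ℝ} (hf : ∀ k, Differentiable ℝ (f k)) :
    partialD i (fun x => ∏ k, f k x) =
      fun x => ∑ k, ∏ j, Function.update f k (partialD i (f k)) j x := by
  funext x
  simp only [partialD]
  rw [(HasFDerivAt.finsetProd fun k (_ : k ∈ Finset.univ) => (hf k x).hasFDerivAt).fderiv,
    sum_apply]
  refine Finset.sum_congr rfl fun k hk => ?_
  rw [← Finset.mul_prod_erase _ _ hk, Function.update_self, mul_comm]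
  simp only [smul_apply, smul_eq_mul]
  congr 1
  refine Finset.prod_congr rfl fun j hj => ?_
  rw [Function.update_of_ne (Finset.ne_of_mem_erase hj)]

/-- If all derivatives of the factors along sublists of `l` are bounded by `1` at `x`, the
derivative along `l` of the product of `d` factors is bounded by `d ^ |l|` at `x`. -/
lemma abs_partialDList_prod_le {m : ℕ} {ι : Type*} [Fintype ι] [DecidableEq ι]
    (l : List (Fin m)) (x : Fin m → ℝ) {f : ι → (Fin m → ℝ) → ℝ}
    (hf : ∀ k, ContDiff ℝ l.length (f k))
    (hb : ∀ k, ∀ l' : List (Fin m), l'.Sublist l → |partialDList l' (f k) x| ≤ 1) :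
    |partialDList l (fun y => ∏ k, f k y) x| ≤ (Fintype.card ι : ℝ) ^ l.length := by
  induction l generalizing f with
  | nil =>
    change |∏ k, f k x| ≤ _
    rw [Finset.abs_prod, List.length_nil, pow_zero]
    exact Finset.prod_le_one (fun _ _ => abs_nonneg _) fun k _ => hb k [] (List.Sublist.refl _)
  | cons i l ih =>
    have hf' : ∀ k j, ContDiff ℝ l.length (Function.update f k (partialD i (f k)) j) := by
      intro k j
      rcases eq_or_ne j k with rfl | hjk
      · rw [Function.update_self]
        exact contDiff_partialD i (hf j)
      · rw [Function.update_of_ne hjk]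
        exact (hf j).of_le (by simp)
    change |partialDList l (partialD i _) x| ≤ _
    rw [partialD_prod i fun k => (hf k).differentiable (by simp),
      partialDList_sum _ _ fun k _ => contDiff_prod fun j _ => hf' k j]
    refine (Finset.abs_sum_le_sum_abs _ _).trans ?_
    refine (Finset.sum_le_card_nsmul _ _ ((Fintype.card ι : ℝ) ^ l.length) fun k _ => ?_).trans
      (by rw [List.length_cons, pow_succ', nsmul_eq_mul, Finset.card_univ])
    refine ih (hf' k) fun j l' hl' => ?_
    rcases eq_or_ne j k with rfl | hjk
    · rw [Function.update_self]
      exact hb j (i :: l') (hl'.cons_cons i)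
    · rw [Function.update_of_ne hjk]
      exact hb j l' (hl'.cons i)

lemma abs_pdAlpha_le_cknorm {m k : ℕ} {U : Set (Fin m → ℝ)} (hU : IsCompact U)
    {f : (Fin m → ℝ) → ℝ} (hf : ContDiff ℝ k f) {α : Fin m → ℕ} (hα : ∑ i, α i ≤ k)
    {x : Fin m → ℝ} (hx : x ∈ U) : |pdAlpha α f x| ≤ cknorm k U f := by
  refine le_csSup ?_ ⟨α, hα, x, hx, rfl⟩
  have hfin : {β : Fin m → ℕ | ∑ i, β i ≤ k}.Finite :=
    (Set.finite_Iic fun _ : Fin m => k).subset fun β hβ i =>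
      (Finset.single_le_sum (fun _ _ => Nat.zero_le _) (Finset.mem_univ i)).trans hβ
  have hbdd : BddAbove (⋃ β ∈ {β : Fin m → ℕ | ∑ i, β i ≤ k}, (fun y => |pdAlpha β f y|) '' U) := by
    refine (hfin.bddAbove_biUnion).2 fun β hβ => (hU.image ?_).bddAbove
    rw [pdAlpha_eq_partialDList]
    refine (continuous_partialDList _ (hf.of_le ?_)).abs
    rw [length_directions]
    exact_mod_cast hβ
  refine hbdd.mono ?_
  rintro y ⟨β, hβ, z, hz, rfl⟩
  exact Set.mem_biUnion hβ ⟨z, hz, rfl⟩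

/-- If `φ = (φ_1,…,φ_n) : U → [−1,1]^n` is a `C^ν` map with `‖φ_j‖_ν ≤ 1` for each `j`,
and `e = (e_0,…,e_n)` is a multi-index with `|e| = δ ≥ 1`, then
`ψ(u) = (1, φ(u))^e = φ_1(u)^{e_1} ⋯ φ_n(u)^{e_n}` is `C^ν` with `‖ψ‖_ν ≤ δ^ν`. -/
theorem monomial_of_map_cknorm_bound {m n : ℕ} (U : Set (Fin m → ℝ)) (hU : IsCompact U)
    (ν : ℕ) (φ : (Fin m → ℝ) → (Fin n → ℝ))
    (hsmooth : ∀ j, ContDiff ℝ ν (fun x => φ x j))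
    (hmap : ∀ x ∈ U, ∀ j, φ x j ∈ Set.Icc (-1 : ℝ) 1)
    (hnorm : ∀ j, cknorm ν U (fun x => φ x j) ≤ 1)
    (e : Fin (n + 1) → ℕ) (δ : ℕ) (hδ : 1 ≤ δ) (he : ∑ i, e i = δ) :
    ContDiff ℝ ν (fun u => ∏ j : Fin n, (φ u j) ^ (e j.succ)) ∧
      cknorm ν U (fun u => ∏ j : Fin n, (φ u j) ^ (e j.succ)) ≤ (δ : ℝ) ^ ν := by
  refine ⟨contDiff_prod fun j _ => (hsmooth j).pow _, Real.sSup_le ?_ (by positivity)⟩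
  rintro y ⟨α, hα, x, hx, rfl⟩
  have hprod : (fun u => ∏ j : Fin n, (φ u j) ^ (e j.succ)) =
      fun u => ∏ k : (Σ j : Fin n, Fin (e j.succ)), φ u k.1 := by
    funext u
    simp [Fintype.prod_sigma]
  have hcard : Fintype.card (Σ j : Fin n, Fin (e j.succ)) ≤ δ := by
    rw [Fintype.card_sigma, ← he, Fin.sum_univ_succ]
    simp
  have hlen : (directions α).length ≤ ν := (length_directions α).trans_le hα
  rw [hprod, pdAlpha_eq_partialDList]
  refine (abs_partialDList_prod_le (f := fun (k : Σ j : Fin n, Fin (e j.succ)) u => φ u k.1)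
    (directions α) x (fun k => (hsmooth k.1).of_le (by exact_mod_cast hlen)) ?_).trans ?_
  · intro k l hl
    have hl' := eq_directions_of_sublist hl
    rw [hl', ← pdAlpha_eq_partialDList]
    refine (abs_pdAlpha_le_cknorm hU (hsmooth k.1) ?_ hx).trans (hnorm k.1)
    rw [← length_directions, ← hl']
    exact hl.length_le.trans hlen
  · calc (Fintype.card (Σ j : Fin n, Fin (e j.succ)) : ℝ) ^ (directions α).length
        ≤ (δ : ℝ) ^ (directions α).length := by gcongr
      _ ≤ (δ : ℝ) ^ ν := pow_le_pow_right₀ (by exact_mod_cast hδ) hlen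
end

section
/- Fix integers m ≥ 1, d ≥ 1 and a real constant C ≥ 0. There is a constant C' = C'(m,d,C) such that the following holds: if δ ≥ 1 and μ, ν are positive integers satisfying |μ − (d/m!)·δ^m| ≤ C·δ^{m−1} and D_m(ν−1) ≤ μ ≤ D_m(ν), then |ν − d^{1/m}·δ| ≤ C'. -/
/-- `L_m(k) = #{α ∈ ℤ_{≥0}^m : |α| = k}`. -/
def Lfn (m k : ℕ) : ℕ := Nat.choose (k + m - 1) (m - 1)

/-- `D_m(k) = #{α ∈ ℤ_{≥0}^m : |α| ≤ k}`. -/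
def Dfn (m k : ℕ) : ℕ := Nat.choose (k + m) m

/-- `n ^ m ≤ m! * D_m(n - 1)` for `n ≥ 1`. -/
theorem pow_le_factorial_mul_Dfn (m n : ℕ) (hn : 1 ≤ n) :
    n ^ m ≤ m.factorial * Dfn m (n - 1) := by
  obtain ⟨k, rfl⟩ := Nat.exists_eq_add_of_le' hn
  rw [Dfn, Nat.add_sub_cancel, ← Nat.ascFactorial_eq_factorial_mul_choose]
  exact Nat.pow_succ_le_ascFactorial _ _

/-- `m! * D_m(n) ≤ (n + m) ^ m`. -/
theorem factorial_mul_Dfn_le_pow (m n : ℕ) : m.factorial * Dfn m n ≤ (n + m) ^ m := by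
  rw [Dfn, ← Nat.ascFactorial_eq_factorial_mul_choose]
  exact Nat.ascFactorial_le_pow_add _ _

/-- If `y ^ (k + 1)` exceeds `x ^ (k + 1)` by at most `K * x ^ k`, then `y ≤ x + K`. -/
theorem le_add_of_pow_succ_le {x y K : ℝ} {k : ℕ} (hx : 0 ≤ x) (hK : 0 ≤ K)
    (h : y ^ (k + 1) ≤ x ^ (k + 1) + K * x ^ k) : y ≤ x + K := by
  refine le_of_pow_le_pow_left₀ k.succ_ne_zero (by positivity) (h.trans ?_)
  have hk : x ^ k ≤ (x + K) ^ k := by gcongr; linarith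
  calc x ^ (k + 1) + K * x ^ k = x ^ k * (x + K) := by ring
    _ ≤ (x + K) ^ k * (x + K) := by gcongr
    _ = (x + K) ^ (k + 1) := by ring

/-- If `y ^ (k + 1)` falls short of `x ^ (k + 1)` by at most `K * x ^ k`, then `x - K ≤ y`. -/
theorem sub_le_of_le_pow_succ {x y K : ℝ} {k : ℕ} (hy : 0 ≤ y) (hK : 0 ≤ K)
    (h : x ^ (k + 1) - K * x ^ k ≤ y ^ (k + 1)) : x - K ≤ y := by
  rcases le_total x K with hxK | hxK
  · linarith
  refine le_of_pow_le_pow_left₀ k.succ_ne_zero hy (le_trans ?_ h)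
  have hs : 0 ≤ x - K := sub_nonneg.2 hxK
  have hk : (x - K) ^ k ≤ x ^ k := by gcongr; linarith
  calc (x - K) ^ (k + 1) = (x - K) ^ k * (x - K) := by ring
    _ ≤ x ^ k * (x - K) := by gcongr
    _ = x ^ (k + 1) - K * x ^ k := by ring

/-- If `μ = (d/m!)·δ^m + O(δ^{m−1})` and `ν` is chosen with `D_m(ν−1) ≤ μ ≤ D_m(ν)`,
then `ν = d^{1/m}·δ + O(1)`, with implied constant depending only on `m`, `d` and the
constant in the hypothesis. -/
theorem nu_asymptotic (m d : ℕ) (hm : 1 ≤ m) (hd : 1 ≤ d) (C : ℝ) (hC : 0 ≤ C) :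
    ∃ C' : ℝ, ∀ δ μ ν : ℕ, 1 ≤ δ → 1 ≤ μ → 1 ≤ ν →
      |(μ : ℝ) - ((d : ℝ) / (Nat.factorial m : ℝ)) * (δ : ℝ) ^ m| ≤ C * (δ : ℝ) ^ (m - 1) →
      Dfn m (ν - 1) ≤ μ → μ ≤ Dfn m ν →
      |(ν : ℝ) - (d : ℝ) ^ ((1 : ℝ) / (m : ℝ)) * (δ : ℝ)| ≤ C' := by
  refine ⟨m.factorial * C + m, fun δ μ ν _ _ hν hμ hlo hhi => ?_⟩
  set a : ℝ := (d : ℝ) ^ ((1 : ℝ) / (m : ℝ)) with ha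
  have ha1 : 1 ≤ a := Real.one_le_rpow (by exact_mod_cast hd) (by positivity)
  have ham : a ^ m = d := by
    rw [ha, one_div, Real.rpow_inv_natCast_pow (by positivity) (by omega)]
  have hx : (0 : ℝ) ≤ a * δ := by positivity
  have hK : (0 : ℝ) ≤ m.factorial * C := by positivity
  have hδx : (δ : ℝ) ≤ a * δ := le_mul_of_one_le_left (by positivity) ha1
  have hμx : |m.factorial * (μ : ℝ) - (a * δ) ^ m| ≤
      m.factorial * C * (a * δ) ^ (m - 1) := by
    have hf : (0 : ℝ) < m.factorial := by positivity
    calc |m.factorial * (μ : ℝ) - (a * δ) ^ m|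
        = m.factorial * |(μ : ℝ) - d / m.factorial * (δ : ℝ) ^ m| := by
          rw [← abs_of_pos hf, ← abs_mul, abs_of_pos hf, mul_pow, ham]
          congr 1
          field_simp
      _ ≤ m.factorial * (C * (δ : ℝ) ^ (m - 1)) := by gcongr
      _ ≤ m.factorial * (C * (a * δ) ^ (m - 1)) := by gcongr
      _ = m.factorial * C * (a * δ) ^ (m - 1) := by ring
  obtain ⟨h₁, h₂⟩ := abs_le.1 hμx
  have hlow : (ν : ℝ) ^ m ≤ m.factorial * (μ : ℝ) := by
    exact_mod_cast (pow_le_factorial_mul_Dfn m ν hν).trans (Nat.mul_le_mul_left _ hlo)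
  have hhigh : m.factorial * (μ : ℝ) ≤ ((ν : ℝ) + m) ^ m := by
    exact_mod_cast (Nat.mul_le_mul_left _ hhi).trans (factorial_mul_Dfn_le_pow m ν)
  have hm' : m - 1 + 1 = m := Nat.sub_add_cancel hm
  have hupper : (ν : ℝ) ≤ a * δ + m.factorial * C :=
    le_add_of_pow_succ_le (k := m - 1) hx hK (by rw [hm']; linarith)
  have hlower : a * δ - m.factorial * C ≤ (ν : ℝ) + m :=
    sub_le_of_le_pow_succ (k := m - 1) (by positivity) hK (by rw [hm']; linarith)
  have hm0 : (0 : ℝ) ≤ m := by positivity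
  exact abs_le.2 ⟨by linarith, by linarith⟩
end

section
/- Fix integers m ≥ 1, d ≥ 1 and a real constant C ≥ 0. There is a constant C' = C'(m,d,C) such that the following holds: if δ ≥ 1 and μ, ν are positive integers satisfying |μ − (d/m!)·δ^m| ≤ C·δ^{m−1} and D_m(ν−1) ≤ μ ≤ D_m(ν), and if f = Σ_{i=0}^{ν−1} i·L_m(i) + ν·(μ − D_m(ν−1)), then |f − (d^{(m+1)/m}/((m+1)·(m−1)!))·δ^{m+1}| ≤ C'·δ^m. -/
open Nat in
lemma pow_le_factorial_mul_choose (k m : ℕ) : (k + 1) ^ m ≤ m ! * (k + m).choose m :=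
  Nat.ascFactorial_eq_factorial_mul_choose k m ▸ Nat.pow_succ_le_ascFactorial (k + 1) m

open Nat in
lemma factorial_mul_choose_le_pow (k m : ℕ) : m ! * (k + m).choose m ≤ (k + m) ^ m :=
  Nat.ascFactorial_eq_factorial_mul_choose k m ▸ Nat.ascFactorial_le_pow_add k m

lemma sum_mul_choose_add_choose (n k : ℕ) :
    ∑ i ∈ Finset.range (k + 1), i * (i + n).choose n + (k + n + 2).choose (n + 2) =
      (k + 1) * (k + n + 1).choose (n + 1) := by
  induction k with
  | zero => simp
  | succ k ih =>
    rw [Finset.sum_range_succ]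
    have h₁ : (k + 1 + n + 2).choose (n + 2) =
        (k + n + 2).choose (n + 1) + (k + n + 2).choose (n + 2) := by
      rw [show k + 1 + n + 2 = k + n + 2 + 1 by ring, Nat.choose_succ_succ]
    have h₂ : (k + 1 + n + 1).choose (n + 1) =
        (k + n + 1).choose n + (k + n + 1).choose (n + 1) := by
      rw [show k + 1 + n + 1 = k + n + 1 + 1 by ring, Nat.choose_succ_succ]
    have h₃ : k + 1 + n = k + n + 1 := by ring
    have h₄ : (k + n + 2).choose (n + 1) =
        (k + n + 1).choose n + (k + n + 1).choose (n + 1) := Nat.choose_succ_succ _ _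
    rw [h₁, h₂, h₃, h₄]
    linear_combination ih

/-- The weighted count `f` equals `ν * μ - (ν + m).choose (m + 1)`, with `ν = k + 1`. -/
lemma sum_mul_Lfn_add_choose {m k μ : ℕ} (hm : 1 ≤ m) (hμ : Dfn m k ≤ μ) :
    ∑ i ∈ Finset.range (k + 1), i * Lfn m i + (k + 1) * (μ - Dfn m k) +
      (k + (m + 1)).choose (m + 1) = (k + 1) * μ := by
  obtain ⟨n, rfl⟩ := Nat.exists_eq_add_of_le' hm
  obtain ⟨r, rfl⟩ := Nat.exists_eq_add_of_le hμ
  have h := sum_mul_choose_add_choose n k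
  simp only [Lfn, Dfn, Nat.add_sub_cancel_left, Nat.add_sub_cancel, ← add_assoc] at *
  linear_combination h

/-- If `x` is within `K` of `s * δ`, then `x ^ (n + 1)` is within `O(δ ^ n)` of its `n + 1`-st
power. -/
lemma abs_pow_succ_sub_pow_succ_le {x s δ K : ℝ} (n : ℕ) (hx : 0 ≤ x) (hs : 0 ≤ s) (hδ : 1 ≤ δ)
    (hK : 0 ≤ K) (h : |x - s * δ| ≤ K) :
    |x ^ (n + 1) - (s * δ) ^ (n + 1)| ≤ K * (n + 1) * (s + K) ^ n * δ ^ n := by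
  have hsδ : 0 ≤ s * δ := by positivity
  have hmax : max |x| |s * δ| ≤ (s + K) * δ := by
    rw [abs_of_nonneg hx, abs_of_nonneg hsδ]
    have := (abs_le.mp h).2
    exact max_le (by nlinarith) (by nlinarith)
  calc |x ^ (n + 1) - (s * δ) ^ (n + 1)|
      ≤ |x - s * δ| * (n + 1 : ℕ) * max |x| |s * δ| ^ n := abs_pow_sub_pow_le _ _ _
    _ ≤ K * (n + 1 : ℕ) * ((s + K) * δ) ^ n := by gcongr
    _ = _ := by rw [mul_pow]; push_cast; ring

/-- If `x ^ m ≤ y ≤ (x + a) ^ m` and `y` is within `A * t ^ (m - 1)` of `t ^ m`, then `x` is within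
`A + a` of `t`. -/
lemma abs_sub_le_of_pow_le_of_le_pow {n : ℕ} {x y t a A : ℝ} (hx : 0 ≤ x) (ht : 0 ≤ t)
    (ha : 0 ≤ a) (hA : 0 ≤ A) (hxy : x ^ (n + 1) ≤ y) (hyx : y ≤ (x + a) ^ (n + 1))
    (hy : |y - t ^ (n + 1)| ≤ A * t ^ n) : |x - t| ≤ A + a := by
  obtain ⟨hy₁, hy₂⟩ := abs_le.mp hy
  have hupper : x ≤ t + A := by
    refine le_of_pow_le_pow_left₀ n.succ_ne_zero (by positivity) ?_
    have : (t + A) * t ^ n ≤ (t + A) * (t + A) ^ n := by gcongr; linarith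
    calc x ^ (n + 1) ≤ (t + A) * t ^ n := by rw [add_mul, ← pow_succ']; linarith
      _ ≤ _ := by rwa [pow_succ']
  have hlower : t - A ≤ x + a := by
    rcases le_total t A with h | h
    · linarith
    refine le_of_pow_le_pow_left₀ n.succ_ne_zero (by positivity) ?_
    have : (t - A) * (t - A) ^ n ≤ (t - A) * t ^ n := by
      have : 0 ≤ t - A := by linarith
      gcongr
      linarith
    calc (t - A) ^ (n + 1) ≤ (t - A) * t ^ n := by rwa [pow_succ']
      _ ≤ (x + a) ^ (n + 1) := by rw [sub_mul, ← pow_succ']; linarith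
  exact abs_le.mpr ⟨by linarith, by linarith⟩

/-- The binomial coefficient `(ν + m).choose (m + 1)`, with `ν = k + 1`, differs from
`(s * δ) ^ (m + 1) / (m + 1)!` by `O(δ ^ m)` when `ν` is within `K` of `s * δ`. -/
lemma abs_factorial_mul_choose_sub_le {k m : ℕ} {s δ K : ℝ} (hs : 0 ≤ s) (hδ : 1 ≤ δ)
    (h : |((k + 1 : ℕ) : ℝ) - s * δ| ≤ K) :
    |(Nat.factorial (m + 1) : ℝ) * ((k + (m + 1)).choose (m + 1) : ℝ) - (s * δ) ^ (m + 1)| ≤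
      (K + m) * (m + 1) * (s + (K + m)) ^ m * δ ^ m := by
  have hm : (0 : ℝ) ≤ m := m.cast_nonneg
  have hK : 0 ≤ K := (abs_nonneg _).trans h
  obtain ⟨h₁, h₂⟩ := abs_le.mp h
  have hlow := abs_pow_succ_sub_pow_succ_le m (Nat.cast_nonneg (k + 1)) hs hδ
    (add_nonneg hK hm) (h.trans (by linarith))
  have hhigh := abs_pow_succ_sub_pow_succ_le (x := ((k + (m + 1) : ℕ) : ℝ)) m (Nat.cast_nonneg _)
    hs hδ (add_nonneg hK hm) (abs_le.mpr (by push_cast at *; constructor <;> linarith))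
  have hc₁ : ((k + 1 : ℕ) : ℝ) ^ (m + 1) ≤
      (Nat.factorial (m + 1) : ℝ) * ((k + (m + 1)).choose (m + 1) : ℝ) := by
    exact_mod_cast pow_le_factorial_mul_choose k (m + 1)
  have hc₂ : (Nat.factorial (m + 1) : ℝ) * ((k + (m + 1)).choose (m + 1) : ℝ) ≤
      ((k + (m + 1) : ℕ) : ℝ) ^ (m + 1) := by
    exact_mod_cast factorial_mul_choose_le_pow k (m + 1)
  exact abs_le.mpr ⟨by linarith [(abs_le.mp hlow).1], by linarith [(abs_le.mp hhigh).2]⟩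

/-- The index `ν = k + 1` is within `m! * C + m` of `s * δ`, where `s ^ m = d`. -/
lemma abs_index_sub_le {n d k μ δ : ℕ} {C s : ℝ} (hC : 0 ≤ C) (hs : 1 ≤ s)
    (hsd : s ^ (n + 1) = d)
    (h : |(μ : ℝ) - (d / (Nat.factorial (n + 1) : ℝ)) * (δ : ℝ) ^ (n + 1)| ≤ C * (δ : ℝ) ^ n)
    (h₁ : Dfn (n + 1) k ≤ μ) (h₂ : μ ≤ Dfn (n + 1) (k + 1)) :
    |((k + 1 : ℕ) : ℝ) - s * δ| ≤ Nat.factorial (n + 1) * C + (n + 1 : ℕ) := by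
  have hF : (0 : ℝ) < Nat.factorial (n + 1) := by positivity
  refine abs_sub_le_of_pow_le_of_le_pow (n := n) (y := Nat.factorial (n + 1) * μ)
    (by positivity) (by positivity) (by positivity) (by positivity) ?_ ?_ ?_
  · exact_mod_cast (pow_le_factorial_mul_choose k (n + 1)).trans (Nat.mul_le_mul_left _ h₁)
  · exact_mod_cast (Nat.mul_le_mul_left _ h₂).trans (factorial_mul_choose_le_pow (k + 1) (n + 1))
  · have hy : (Nat.factorial (n + 1) : ℝ) * μ - (s * δ) ^ (n + 1) = Nat.factorial (n + 1) *
        (μ - (d / (Nat.factorial (n + 1) : ℝ)) * (δ : ℝ) ^ (n + 1)) := by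
      rw [mul_pow, hsd]
      field_simp
    rw [hy, abs_mul, abs_of_pos hF, mul_assoc]
    gcongr
    refine h.trans ?_
    gcongr
    exact le_mul_of_one_le_left (Nat.cast_nonneg _) hs

/-- If `μ = (d/m!)·δ^m + O(δ^{m−1})`, `D_m(ν−1) ≤ μ ≤ D_m(ν)`, and
`f = Σ_{i=0}^{ν−1} i·L_m(i) + ν(μ − D_m(ν−1))`, then
`f = (d^{(m+1)/m}/((m+1)(m−1)!))·δ^{m+1} + O(δ^m)`, with implied constant depending
only on `m`, `d` and the constant in the hypothesis. -/
theorem f_asymptotic (m d : ℕ) (hm : 1 ≤ m) (hd : 1 ≤ d) (C : ℝ) (hC : 0 ≤ C) :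
    ∃ C' : ℝ, ∀ δ μ ν : ℕ, 1 ≤ δ → 1 ≤ μ → 1 ≤ ν →
      |(μ : ℝ) - ((d : ℝ) / (Nat.factorial m : ℝ)) * (δ : ℝ) ^ m| ≤ C * (δ : ℝ) ^ (m - 1) →
      Dfn m (ν - 1) ≤ μ → μ ≤ Dfn m ν →
      ∀ f : ℕ, f = ∑ i ∈ Finset.range ν, i * Lfn m i + ν * (μ - Dfn m (ν - 1)) →
      |(f : ℝ) - ((d : ℝ) ^ (((m : ℝ) + 1) / (m : ℝ)) /
          (((m : ℝ) + 1) * (Nat.factorial (m - 1) : ℝ))) * (δ : ℝ) ^ (m + 1)| ≤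
        C' * (δ : ℝ) ^ m := by
  obtain ⟨n, rfl⟩ := Nat.exists_eq_add_of_le' hm
  set s : ℝ := (d : ℝ) ^ (((n + 1 : ℕ) : ℝ)⁻¹) with hs_def
  have hd' : (1 : ℝ) ≤ d := by exact_mod_cast hd
  have hs : 1 ≤ s := Real.one_le_rpow hd' (by positivity)
  have hsd : s ^ (n + 1) = d := Real.rpow_inv_natCast_pow (by positivity) n.succ_ne_zero
  have hsd' : (d : ℝ) ^ ((((n + 1 : ℕ) : ℝ) + 1) / ((n + 1 : ℕ) : ℝ)) = s ^ (n + 2) := by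
    rw [hs_def, ← Real.rpow_mul_natCast (by positivity)]
    congr 1
    push_cast
    ring
  set F : ℝ := (Nat.factorial (n + 1) : ℝ) with hF_def
  have hF : 0 < F := by positivity
  set K : ℝ := F * C + (n + 1 : ℕ)
  set B : ℝ := (K + (n + 1 : ℕ)) * ((n + 1 : ℕ) + 1) * (s + (K + (n + 1 : ℕ))) ^ (n + 1)
  have hF₂ : (Nat.factorial (n + 1 + 1) : ℝ) = (n + 2) * F := by
    rw [Nat.factorial_succ, hF_def]
    push_cast
    ring
  have hF₀ : F = (n + 1) * (Nat.factorial n : ℝ) := by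
    rw [hF_def, Nat.factorial_succ]
    push_cast
    ring
  refine ⟨K * (d / F + C) + s * C + B / ((n + 2) * F), ?_⟩
  intro δ μ ν hδ _ hν hμ h₁ h₂ f hf
  obtain ⟨k, rfl⟩ := Nat.exists_eq_add_of_le' hν
  simp only [Nat.add_sub_cancel] at hμ h₁ hf ⊢
  have hδ' : (1 : ℝ) ≤ δ := by exact_mod_cast hδ
  have hindex : |((k + 1 : ℕ) : ℝ) - s * δ| ≤ K := abs_index_sub_le hC hs hsd hμ h₁ h₂
  have hchoose := abs_factorial_mul_choose_sub_le (m := n + 1) (by positivity) hδ' hindex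
  have hexact : (f : ℝ) + ((k + (n + 1 + 1)).choose (n + 1 + 1) : ℝ) = (k + 1 : ℕ) * μ := by
    exact_mod_cast hf ▸ sum_mul_Lfn_add_choose hm h₁
  rw [hF₂] at hchoose
  rw [hsd']
  set c : ℝ := ((k + (n + 1 + 1)).choose (n + 1 + 1) : ℝ)
  have hsplit : (f : ℝ) - s ^ (n + 2) / ((((n + 1 : ℕ) : ℝ) + 1) * (Nat.factorial n : ℝ)) *
        (δ : ℝ) ^ (n + 1 + 1) =
      ((k + 1 : ℕ) - s * δ) * μ + s * δ * (μ - d / F * (δ : ℝ) ^ (n + 1)) -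
        ((n + 2) * F * c - (s * δ) ^ (n + 1 + 1)) / ((n + 2) * F) := by
    rw [eq_sub_of_add_eq hexact, ← hsd, hF₀]
    push_cast
    field_simp
    ring
  have hμ_le : (μ : ℝ) ≤ (d / F + C) * (δ : ℝ) ^ (n + 1) := by
    have hpow : C * (δ : ℝ) ^ n ≤ C * (δ : ℝ) ^ (n + 1) := by
      gcongr
      simp
    linarith [(abs_le.mp hμ).2]
  have hfirst : |(((k + 1 : ℕ) : ℝ) - s * δ) * μ| ≤ K * ((d / F + C) * (δ : ℝ) ^ (n + 1)) := by
    rw [abs_mul, Nat.abs_cast]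
    gcongr
  have hsecond : |s * δ * (μ - d / F * (δ : ℝ) ^ (n + 1))| ≤ s * δ * (C * (δ : ℝ) ^ n) := by
    rw [abs_mul, abs_of_nonneg (by positivity : 0 ≤ s * (δ : ℝ))]
    gcongr
  have hthird : |((n + 2) * F * c - (s * δ) ^ (n + 1 + 1)) / ((n + 2) * F)| ≤
      B * (δ : ℝ) ^ (n + 1) / ((n + 2) * F) := by
    rw [abs_div, abs_of_pos (by positivity : 0 < (n + 2) * F)]
    gcongr
  rw [hsplit]
  refine (abs_sub _ _).trans ((add_le_add ((abs_add_le _ _).trans (add_le_add hfirst hsecond))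
    hthird).trans_eq ?_)
  ring
end
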